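/- Theorem (main). Assume condition (exp). Then the number of multisets satisfies c_n ∼ (e^{nσ_n} / √(2π B_n²)) · Π_{j=1}^n (1 − e^{−jσ_n})^{−a_j} as n → ∞, i.e. the ratio of the two sides tends to 1. -/

import Mathlib

open Finset Filter

/-- The number of multisets of total size `n` determined by the parameters `a j`
(the number of one-component multisets of size `j`), i.e.
`c_n = Σ_{η ∈ Ω_n} Π_{j=1}^n C(a_j + η_j - 1, η_j)` where
`Ω_n = {η : Σ_{j=1}^n j·η_j = n}` (indices shifted: `j ∈ Fin n` stands for `j+1`). -/
def multisetCount (a : ℕ → ℕ) (n : ℕ) : ℕ :=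
  ∑ η : Fin n → Fin (n + 1),
    if ∑ j : Fin n, (j.1 + 1) * (η j).1 = n then
      ∏ j : Fin n, Nat.choose (a (j.1 + 1) + (η j).1 - 1) (η j).1
    else 0

/-- `M_n(σ) = Σ_{j=1}^n j a_j e^{-jσ}/(1-e^{-jσ})`. -/
noncomputable def Mfun (a : ℕ → ℕ) (n : ℕ) (σ : ℝ) : ℝ :=
  ∑ j ∈ Finset.Icc 1 n, (j : ℝ) * (a j) * Real.exp (-(j * σ)) / (1 - Real.exp (-(j * σ)))

/-- `B_n²(σ) = Σ_{j=1}^n j² a_j e^{-jσ}/(1-e^{-jσ})²`. -/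
noncomputable def B2 (a : ℕ → ℕ) (n : ℕ) (σ : ℝ) : ℝ :=
  ∑ j ∈ Finset.Icc 1 n, (j : ℝ) ^ 2 * (a j) * Real.exp (-(j * σ)) / (1 - Real.exp (-(j * σ))) ^ 2

/-- Condition (exp): `a_j ≍ j^{r-1} y^j`, i.e. there are constants `D₁, D₂ > 0` with
`D₁ j^{r-1} y^j ≤ a_j ≤ D₂ j^{r-1} y^j` for all `j ≥ 1`. -/
def ExpansiveCond (a : ℕ → ℕ) (r y : ℝ) : Prop :=
  ∃ D₁ D₂ : ℝ, 0 < D₁ ∧ 0 < D₂ ∧ ∀ j : ℕ, 1 ≤ j →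
    D₁ * (j : ℝ) ^ (r - 1) * y ^ j ≤ (a j : ℝ) ∧ (a j : ℝ) ≤ D₂ * (j : ℝ) ^ (r - 1) * y ^ j

lemma aux_bdd (s c : ℝ) (hc : 0 < c) : ∃ C : ℝ, 0 < C ∧ ∀ u : ℝ, 0 < u → u ^ s * Real.exp (-(c * u)) ≤ C ∨ u < 1 := by
  obtain ⟨k, hk⟩ := exists_nat_ge s
  refine ⟨(k.factorial : ℝ) / c ^ k, by positivity, fun u hu => ?_⟩
  by_cases h1 : u < 1
  · right; exact h1
  left
  push Not at h1
  have h2 : u ^ s ≤ u ^ k := by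
    rw [← Real.rpow_natCast]
    exact Real.rpow_le_rpow_of_exponent_le h1 hk
  have h3 := Real.pow_div_factorial_le_exp (c * u) (by positivity) k
  rw [Real.exp_neg, ← div_eq_mul_inv, div_le_div_iff₀ (Real.exp_pos _) (by positivity)]
  rw [div_le_iff₀ (by positivity), mul_pow] at h3
  calc u ^ s * c ^ k ≤ u ^ k * c ^ k := by gcongr
    _ ≤ _ := by linarith

lemma aux_bdd_nonneg (s c : ℝ) (hs : 0 ≤ s) (hc : 0 < c) :
    ∃ C : ℝ, 0 < C ∧ ∀ u : ℝ, 0 < u → u ^ s * Real.exp (-(c * u)) ≤ C := by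
  obtain ⟨C, hC, h⟩ := aux_bdd s c hc
  refine ⟨C + 1, by positivity, fun u hu => ?_⟩
  rcases h u hu with h | h
  · linarith
  · have h1 : u ^ s ≤ 1 := Real.rpow_le_one hu.le h.le hs
    have h2 : Real.exp (-(c * u)) ≤ 1 := by
      rw [Real.exp_le_one_iff]
      have : 0 < c * u := by positivity
      linarith
    have h3 : u ^ s * Real.exp (-(c * u)) ≤ 1 * 1 := by gcongr
    linarith

lemma one_sub_exp_lower (u : ℝ) (hu : 0 < u) : u / (1 + u) ≤ 1 - Real.exp (-u) := by
  have h := Real.add_one_le_exp u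
  have h2 : Real.exp (-u) ≤ 1 / (1 + u) := by
    rw [Real.exp_neg, ← one_div]
    apply one_div_le_one_div_of_le <;> linarith
  have h3 : u / (1 + u) = 1 - 1 / (1 + u) := by field_simp; ring
  linarith

lemma geom_bound (c : ℝ) (hc : 0 < c) (n : ℕ) :
    ∑ j ∈ Finset.Icc 1 n, Real.exp (-(j * c)) ≤ 1 / c := by
  have key : ∀ n : ℕ, c * ∑ j ∈ Finset.Icc 1 n, Real.exp (-(j * c)) ≤ 1 - Real.exp (-(n * c)) := by
    intro n
    induction n with
    | zero => simp
    | succ n ih =>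
      rw [Finset.sum_Icc_succ_top (by omega), mul_add]
      have h : Real.exp (-(n * c)) = Real.exp (-((n + 1 : ℕ) * c)) * Real.exp c := by
        rw [← Real.exp_add]; congr 1; push_cast; ring
      have h2 := Real.add_one_le_exp c
      have h3 := Real.exp_pos (-((n + 1 : ℕ) * c))
      nlinarith
  rw [le_div_iff₀ hc]
  have := key n
  have h3 := Real.exp_pos (-(n * c))
  linarith

/-- powers with nonnegative exponent -/
lemma sum_pow_exp_nonneg (s : ℝ) (hs : 0 ≤ s) : ∃ C : ℝ, 0 < C ∧ ∀ δ : ℝ, 0 < δ → ∀ n : ℕ,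
    ∑ j ∈ Finset.Icc 1 n, (j : ℝ) ^ s * Real.exp (-(j * δ)) ≤ C * δ ^ (-(s + 1)) := by
  obtain ⟨C, hC, h⟩ := aux_bdd_nonneg s (1 / 2) hs (by norm_num)
  refine ⟨2 * C, by positivity, fun δ hδ n => ?_⟩
  have h1 : ∀ j ∈ Finset.Icc 1 n, (j : ℝ) ^ s * Real.exp (-(j * δ)) ≤
      C * δ ^ (-s) * Real.exp (-(j * (δ / 2))) := by
    intro j hj
    have hj1 : (0 : ℝ) < j := by
      have := (Finset.mem_Icc.1 hj).1
      exact_mod_cast this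
    have h2 := h (j * δ) (by positivity)
    have h3 : (j : ℝ) ^ s * Real.exp (-(j * δ)) =
        ((j * δ) ^ s * Real.exp (-(1 / 2 * (j * δ)))) * δ ^ (-s) * Real.exp (-(j * (δ / 2))) := by
      rw [Real.mul_rpow hj1.le hδ.le, Real.rpow_neg hδ.le]
      have : Real.exp (-(j * δ)) = Real.exp (-(1 / 2 * (j * δ))) * Real.exp (-(j * (δ / 2))) := by
        rw [← Real.exp_add]; congr 1; ring
      rw [this]
      have : δ ^ s ≠ 0 := by positivity
      field_simp
    rw [h3]
    gcongr
  refine (Finset.sum_le_sum h1).trans ?_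
  rw [← Finset.mul_sum]
  have h4 := geom_bound (δ / 2) (by positivity) n
  calc C * δ ^ (-s) * ∑ j ∈ Finset.Icc 1 n, Real.exp (-(j * (δ / 2))) ≤ C * δ ^ (-s) * (1 / (δ / 2)) := by
        gcongr
    _ = 2 * C * δ ^ (-(s + 1)) := by
        rw [neg_add, Real.rpow_add hδ, Real.rpow_neg_one]
        field_simp

lemma sum_pow_exp (r : ℝ) (hr : 0 < r) : ∃ C : ℝ, 0 < C ∧ ∀ δ : ℝ, 0 < δ → ∀ n : ℕ,
    ∑ j ∈ Finset.Icc 1 n, (j : ℝ) ^ (r - 1) * Real.exp (-(j * δ)) ≤ C * δ ^ (-r) := by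
  by_cases h1 : 1 ≤ r
  · obtain ⟨C, hC, h⟩ := sum_pow_exp_nonneg (r - 1) (by linarith)
    refine ⟨C, hC, fun δ hδ n => ?_⟩
    have := h δ hδ n
    simpa using this
  push Not at h1
  obtain ⟨C, hC, h⟩ := sum_pow_exp_nonneg r hr.le
  obtain ⟨C', hC', h'⟩ := aux_bdd_nonneg r 1 hr.le (by norm_num)
  refine ⟨(C + C') / r, by positivity, fun δ hδ n => ?_⟩
  have key : ∀ n : ℕ, r * ∑ j ∈ Finset.Icc 1 n, (j : ℝ) ^ (r - 1) * Real.exp (-(j * δ)) ≤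
      (n : ℝ) ^ r * Real.exp (-(n * δ)) + δ * ∑ j ∈ Finset.range n, (j : ℝ) ^ r * Real.exp (-(j * δ)) := by
    intro n
    induction n with
    | zero => simp [Real.zero_rpow hr.ne']
    | succ n ih =>
      rw [Finset.sum_Icc_succ_top (by omega), mul_add, Finset.sum_range_succ, mul_add]
      have hn : (0 : ℝ) < (n + 1 : ℕ) := by positivity
      have e1 : r * ((n + 1 : ℕ) : ℝ) ^ (r - 1) ≤ ((n + 1 : ℕ) : ℝ) ^ r - (n : ℝ) ^ r := by
        have hb := rpow_one_add_le_one_add_mul_self (s := -1 / ((n + 1 : ℕ) : ℝ)) (p := r)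
          (by rw [le_div_iff₀ hn]; push_cast; linarith [Nat.cast_nonneg (α := ℝ) n]) hr.le h1.le
        have e2 : (n : ℝ) = ((n + 1 : ℕ) : ℝ) * (1 + -1 / ((n + 1 : ℕ) : ℝ)) := by
          field_simp; push_cast; ring
        have e3 : (0 : ℝ) ≤ 1 + -1 / ((n + 1 : ℕ) : ℝ) := by
          have : 1 + -1 / ((n + 1 : ℕ) : ℝ) = n / ((n + 1 : ℕ) : ℝ) := by
            field_simp; push_cast; ring
          rw [this]; positivity
        have e4 : (n : ℝ) ^ r = ((n + 1 : ℕ) : ℝ) ^ r * (1 + -1 / ((n + 1 : ℕ) : ℝ)) ^ r := by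
          rw [← Real.mul_rpow hn.le e3, ← e2]
        rw [e4]
        have e5 : ((n + 1 : ℕ) : ℝ) ^ (r - 1) = ((n + 1 : ℕ) : ℝ) ^ r / ((n + 1 : ℕ) : ℝ) :=
          Real.rpow_sub_one hn.ne' r
        rw [e5]
        have e6 : (0 : ℝ) ≤ ((n + 1 : ℕ) : ℝ) ^ r := by positivity
        calc r * (((n + 1 : ℕ) : ℝ) ^ r / ((n + 1 : ℕ) : ℝ))
            = ((n + 1 : ℕ) : ℝ) ^ r - ((n + 1 : ℕ) : ℝ) ^ r * (1 + r * (-1 / ((n + 1 : ℕ) : ℝ))) := by ring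
          _ ≤ _ := by gcongr
      have e7 : Real.exp (-((n + 1 : ℕ) * δ)) = Real.exp (-(n * δ)) * Real.exp (-δ) := by
        rw [← Real.exp_add]; congr 1; push_cast; ring
      have e8 := Real.add_one_le_exp (-δ)
      have e9 : Real.exp (-(n * δ)) * (1 - δ) ≤ Real.exp (-((n + 1 : ℕ) * δ)) := by
        rw [e7]; gcongr; linarith
      have e10 : (0 : ℝ) ≤ (n : ℝ) ^ r := by positivity
      have e11 := mul_le_mul_of_nonneg_left e9 e10
      have e12 := mul_le_mul_of_nonneg_right e1 (Real.exp_pos (-((n + 1 : ℕ) * δ))).le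
      nlinarith
  have k1 := key n
  have k2 : ∑ j ∈ Finset.range n, (j : ℝ) ^ r * Real.exp (-(j * δ)) ≤
      ∑ j ∈ Finset.Icc 1 n, (j : ℝ) ^ r * Real.exp (-(j * δ)) := by
    rw [← Finset.sum_filter_add_sum_filter_not (Finset.range n) (fun j => j = 0)]
    have : ∑ j ∈ (Finset.range n).filter (fun j => j = 0), (j : ℝ) ^ r * Real.exp (-(j * δ)) = 0 := by
      apply Finset.sum_eq_zero
      intro j hj
      rw [(Finset.mem_filter.1 hj).2]
      simp [Real.zero_rpow hr.ne']
    rw [this, zero_add]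
    apply Finset.sum_le_sum_of_subset_of_nonneg
    · intro j hj
      simp only [Finset.mem_filter, Finset.mem_range, Finset.mem_Icc] at hj ⊢
      omega
    · intros; positivity
  have k3 := h δ hδ n
  have k4 : (n : ℝ) ^ r * Real.exp (-(n * δ)) ≤ C' * δ ^ (-r) := by
    rcases Nat.eq_zero_or_pos n with hn | hn
    · subst hn
      simp only [Nat.cast_zero, Real.zero_rpow hr.ne', zero_mul]; positivity
    have hn' : (0 : ℝ) < n := by exact_mod_cast hn
    have := h' (n * δ) (by positivity)
    rw [Real.mul_rpow hn'.le hδ.le, one_mul] at this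
    rw [Real.rpow_neg hδ.le, ← div_eq_mul_inv, le_div_iff₀ (by positivity)]
    linarith
  have k5 : δ * (C * δ ^ (-(r + 1))) = C * δ ^ (-r) := by
    rw [neg_add, Real.rpow_add hδ, Real.rpow_neg_one]; field_simp
  rw [div_mul_eq_mul_div, le_div_iff₀ hr]
  have k6 := mul_le_mul_of_nonneg_left (k2.trans k3) hδ.le
  nlinarith
/-- `v(1+m)θ^3` bound for the logarithm of the geometric characteristic function -/
lemma one_sub_w_re (m θ : ℝ) (hm : 0 ≤ m) :
    1 ≤ (1 - (m : ℂ) * (Complex.exp (θ * Complex.I) - 1)).re := by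
  have h : (1 - (m : ℂ) * (Complex.exp (θ * Complex.I) - 1)).re = 1 + m * (1 - Real.cos θ) := by
    simp [Complex.exp_ofReal_mul_I_re]; ring
  rw [h]
  have := Real.cos_le_one θ
  nlinarith

lemma one_sub_w_norm (m θ : ℝ) (hm : 0 ≤ m) :
    1 ≤ ‖1 - (m : ℂ) * (Complex.exp (θ * Complex.I) - 1)‖ :=
  (one_sub_w_re m θ hm).trans (Complex.re_le_norm _)

lemma one_sub_w_normSq (m θ : ℝ) :
    ‖1 - (m : ℂ) * (Complex.exp (θ * Complex.I) - 1)‖ ^ 2 =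
      1 + 4 * (m * (1 + m)) * Real.sin (θ / 2) ^ 2 := by
  rw [← Complex.normSq_eq_norm_sq, Complex.normSq_apply]
  have h1 : (1 - (m : ℂ) * (Complex.exp (θ * Complex.I) - 1)).re = 1 + m * (1 - Real.cos θ) := by
    simp [Complex.exp_ofReal_mul_I_re]; ring
  have h2 : (1 - (m : ℂ) * (Complex.exp (θ * Complex.I) - 1)).im = - m * Real.sin θ := by
    simp [Complex.exp_ofReal_mul_I_im]
  rw [h1, h2]
  have h3 : Real.sin (θ / 2) ^ 2 = (1 - Real.cos θ) / 2 := by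
    have := Real.cos_sq (θ / 2)
    rw [Real.sin_sq, this]
    have : 2 * (θ / 2) = θ := by ring
    rw [this]; ring
  rw [h3]
  have := Real.sin_sq_add_cos_sq θ
  linear_combination m ^ 2 * this

lemma F_norm_le (x m θ : ℝ) (hx : 0 ≤ x) (hx1 : x ≤ 1) (hm : 0 ≤ m) (hxm : x ≤ m * (1 + m)) :
    ‖(1 - (m : ℂ) * (Complex.exp (θ * Complex.I) - 1))⁻¹‖ ≤
      Real.exp (-(2 / 5 * (x * Real.sin (θ / 2) ^ 2))) := by
  set q := ‖1 - (m : ℂ) * (Complex.exp (θ * Complex.I) - 1)‖ with hq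
  have h1 : 1 ≤ q := one_sub_w_norm m θ hm
  have h2 : q ^ 2 = 1 + 4 * (m * (1 + m)) * Real.sin (θ / 2) ^ 2 := one_sub_w_normSq m θ
  set s := Real.sin (θ / 2) ^ 2 with hs
  have hs0 : 0 ≤ s := sq_nonneg _
  have hs1 : s ≤ 1 := Real.sin_sq_le_one _
  rw [norm_inv, ← hq, Real.exp_neg]
  apply inv_anti₀ (Real.exp_pos _)
  have h3 : Real.exp (2 / 5 * (x * s)) ^ 2 ≤ q ^ 2 := by
    rw [← Real.exp_nat_mul, h2]
    have hu0 : 0 ≤ x * s := by positivity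
    have hu1 : x * s ≤ 1 := by nlinarith
    have h4 : x * s ≤ m * (1 + m) * s := by gcongr
    have h5 : Real.exp (4 / 5 * (x * s)) ≤ 1 + 4 * (x * s) := by
      have := Real.one_sub_le_exp_neg (4 / 5 * (x * s))
      rw [Real.exp_neg] at this
      have hp := Real.exp_pos (4 / 5 * (x * s))
      have h6 : (1 - 4 / 5 * (x * s)) * Real.exp (4 / 5 * (x * s)) ≤ 1 := by
        calc _ ≤ (Real.exp (4 / 5 * (x * s)))⁻¹ * Real.exp (4 / 5 * (x * s)) := by gcongr
          _ = 1 := inv_mul_cancel₀ hp.ne'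
      have h7 : (1 - 4 / 5 * (x * s)) * (1 + 4 * (x * s)) ≥ 1 := by nlinarith
      have h8 : 0 < 1 - 4 / 5 * (x * s) := by linarith
      exact le_of_mul_le_mul_left (h6.trans h7) h8
    have h6 : ((2 : ℕ) : ℝ) * (2 / 5 * (x * s)) = 4 / 5 * (x * s) := by push_cast; ring
    rw [h6]
    linarith
  exact (sq_le_sq₀ (Real.exp_pos _).le (by linarith)).1 h3

lemma exp_I_sub_one_bound (θ : ℝ) : ‖Complex.exp (θ * Complex.I) - 1‖ ≤ |θ| := by
  have := Real.norm_exp_I_mul_ofReal_sub_one_le (x := θ)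
  rw [mul_comm]
  simpa using this

lemma exp_I_sub_one_sub_bound (θ : ℝ) :
    ‖Complex.exp (θ * Complex.I) - 1 - θ * Complex.I‖ ≤ θ ^ 2 := by
  have hd : ∀ u ∈ Set.uIcc 0 θ, HasDerivWithinAt
      (fun u : ℝ => Complex.exp (u * Complex.I) - 1 - u * Complex.I)
      (Complex.exp (u * Complex.I) * Complex.I - Complex.I) (Set.uIcc 0 θ) u := by
    intro u _
    have h1 : HasDerivAt (fun u : ℝ => (u : ℂ) * Complex.I) Complex.I u := by
      simpa using (Complex.ofRealCLM.hasDerivAt (x := u)).mul_const Complex.I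
    exact ((h1.cexp.sub_const 1).sub h1).hasDerivWithinAt
  have hb : ∀ u ∈ Set.uIcc 0 θ, ‖Complex.exp (u * Complex.I) * Complex.I - Complex.I‖ ≤ |θ| := by
    intro u hu
    have : Complex.exp (u * Complex.I) * Complex.I - Complex.I =
      (Complex.exp (u * Complex.I) - 1) * Complex.I := by ring
    rw [this, norm_mul, Complex.norm_I, mul_one]
    refine (exp_I_sub_one_bound u).trans ?_
    have := Set.abs_sub_left_of_mem_uIcc hu
    simpa using this
  have := (convex_uIcc (0 : ℝ) θ).norm_image_sub_le_of_norm_hasDerivWithin_le hd hb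
    Set.left_mem_uIcc Set.right_mem_uIcc
  simp at this
  nlinarith [abs_mul_abs_self θ]

lemma log_taylor (m θ : ℝ) (hm : 0 ≤ m) :
    ‖-Complex.log (1 - (m : ℂ) * (Complex.exp (θ * Complex.I) - 1)) - m * θ * Complex.I
      + (m * (1 + m)) * θ ^ 2 / 2‖ ≤ m * (1 + m) ^ 2 * |θ| ^ 3 := by
  have hne : ∀ u : ℝ, 1 - (m : ℂ) * (Complex.exp (u * Complex.I) - 1) ≠ 0 := by
    intro u h
    have := one_sub_w_norm m u hm
    rw [h] at this
    simp at this
    linarith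
  have hd : ∀ u ∈ Set.uIcc 0 θ, HasDerivWithinAt
      (fun u : ℝ => -Complex.log (1 - (m : ℂ) * (Complex.exp (u * Complex.I) - 1)) - m * u * Complex.I
      + (m * (1 + m)) * u ^ 2 / 2)
      (-(-((m : ℂ) * (Complex.exp (u * Complex.I) * Complex.I)) /
        (1 - (m : ℂ) * (Complex.exp (u * Complex.I) - 1))) - m * Complex.I + m * (1 + m) * u)
      (Set.uIcc 0 θ) u := by
    intro u _
    have h0 : HasDerivAt (fun u : ℝ => (u : ℂ)) 1 u := by
      exact (hasDerivAt_id u).ofReal_comp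
    have h1 : HasDerivAt (fun u : ℝ => (u : ℂ) * Complex.I) Complex.I u := by
      simpa using h0.mul_const Complex.I
    have h2 : HasDerivAt (fun u : ℝ => 1 - (m : ℂ) * (Complex.exp (u * Complex.I) - 1))
      (-((m : ℂ) * (Complex.exp (u * Complex.I) * Complex.I))) u :=
      ((h1.cexp.sub_const 1).const_mul (m : ℂ)).const_sub 1
    have h3 := h2.clog_real (Or.inl (by have := one_sub_w_re m u hm; linarith))
    have h4 : HasDerivAt (fun u : ℝ => (m : ℂ) * u * Complex.I) (m * Complex.I) u := by
      simpa using (h0.const_mul (m : ℂ)).mul_const Complex.I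
    have h5 : HasDerivAt (fun u : ℝ => ((m : ℂ) * (1 + m)) * (u : ℂ) ^ 2 / 2) ((m : ℂ) * (1 + m) * u) u := by
      have := ((h0.pow 2).const_mul ((m : ℂ) * (1 + m))).div_const 2
      refine (this.congr_deriv ?_)
      simp
      ring
    exact ((h3.neg.sub h4).add h5).hasDerivWithinAt
  have hb : ∀ u ∈ Set.uIcc 0 θ, ‖-(-((m : ℂ) * (Complex.exp (u * Complex.I) * Complex.I)) /
        (1 - (m : ℂ) * (Complex.exp (u * Complex.I) - 1))) - m * Complex.I + m * (1 + m) * u‖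
        ≤ m * (1 + m) ^ 2 * |θ| ^ 2 := by
    intro u hu
    set E := Complex.exp (u * Complex.I) with hE
    have hne' := hne u
    rw [← hE] at hne'
    have e : -(-((m : ℂ) * (E * Complex.I)) / (1 - (m : ℂ) * (E - 1))) - m * Complex.I + m * (1 + m) * u
       = (m * (1 + m)) * (Complex.I * (E - 1 - u * Complex.I) - u * (m * (E - 1))) /
         (1 - (m : ℂ) * (E - 1)) := by
      rw [eq_div_iff hne', add_mul, sub_mul, neg_div, neg_neg, div_mul_cancel₀ _ hne']
      linear_combination ((m : ℂ) * (1 + m) * u) * Complex.I_sq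
    have hut : |u| ≤ |θ| := by
      have := Set.abs_sub_left_of_mem_uIcc hu
      simpa using this
    have n1 : ‖Complex.I * (E - 1 - u * Complex.I) - u * (m * (E - 1))‖ ≤ (1 + m) * |θ| ^ 2 := by
      refine (norm_sub_le _ _).trans ?_
      have b1 : ‖Complex.I * (E - 1 - u * Complex.I)‖ ≤ |u| ^ 2 := by
        rw [norm_mul, Complex.norm_I, one_mul, sq_abs]
        exact exp_I_sub_one_sub_bound u
      have b2 : ‖(u : ℂ) * (m * (E - 1))‖ ≤ |u| * (m * |u|) := by
        rw [norm_mul, norm_mul, Complex.norm_real, Complex.norm_real, Real.norm_eq_abs, Real.norm_eq_abs,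
          abs_of_nonneg hm]
        gcongr
        exact exp_I_sub_one_bound u
      calc _ ≤ |u| ^ 2 + |u| * (m * |u|) := add_le_add b1 b2
        _ ≤ |θ| ^ 2 + |θ| * (m * |θ|) := by gcongr
        _ = _ := by ring
    rw [e, norm_div]
    have n2 : ‖(m : ℂ) * (1 + m)‖ = m * (1 + m) := by
      have : (m : ℂ) * (1 + m) = ((m * (1 + m) : ℝ) : ℂ) := by push_cast; ring
      rw [this, Complex.norm_real, Real.norm_eq_abs, abs_of_nonneg (by positivity)]
    apply div_le_of_le_mul₀ (norm_nonneg _) (by positivity)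
    have n3 := one_sub_w_norm m u hm
    rw [norm_mul, n2]
    calc _ ≤ m * (1 + m) * ((1 + m) * |θ| ^ 2) := by gcongr
      _ = (m * (1 + m) ^ 2 * |θ| ^ 2) * 1 := by ring
      _ ≤ _ := by gcongr
  have := (convex_uIcc (0 : ℝ) θ).norm_image_sub_le_of_norm_hasDerivWithin_le hd hb
    Set.left_mem_uIcc Set.right_mem_uIcc
  simp only [Complex.ofReal_zero, zero_mul, Complex.exp_zero, sub_self, mul_zero, sub_zero, Complex.log_one,
    neg_zero, Real.norm_eq_abs] at this
  refine le_trans (le_of_eq ?_) (this.trans (le_of_eq ?_))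
  · congr 1; ring
  · ring

lemma sin_sq_pair (a b : ℝ) : Real.sin b ^ 2 ≤ 2 * (Real.sin a ^ 2 + Real.sin (a + b) ^ 2) := by
  have h : Real.sin b = Real.sin (a + b) * Real.cos a - Real.cos (a + b) * Real.sin a := by
    rw [← Real.sin_sub]; congr 1; ring
  have h1 := Real.cos_sq_le_one a
  have h2 := Real.cos_sq_le_one (a + b)
  have h3 : (Real.sin (a + b) * Real.cos a) ^ 2 ≤ Real.sin (a + b) ^ 2 := by
    rw [mul_pow]; nlinarith [sq_nonneg (Real.sin (a+b))]
  have h4 : (Real.cos (a + b) * Real.sin a) ^ 2 ≤ Real.sin a ^ 2 := by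
    rw [mul_pow]; nlinarith [sq_nonneg (Real.sin a)]
  rw [h]
  nlinarith [sq_nonneg (Real.sin (a + b) * Real.cos a + Real.cos (a + b) * Real.sin a)]

lemma exists_sin_large (N : ℕ) (hN : 1 ≤ N) (t : ℝ) (ht : |t| ≤ Real.pi) :
    ∃ k : ℕ, k ≤ N ∧ 1 / 16 * min 1 ((N * t) ^ 2) ≤ Real.sin (k * t / 2) ^ 2 := by
  have hpi := Real.pi_pos
  have hpi4 := Real.pi_le_four
  have jordan : ∀ k : ℕ, k * |t| ≤ Real.pi → (k * |t| / Real.pi) ^ 2 ≤ Real.sin (k * t / 2) ^ 2 := by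
    intro k hk
    have h1 : Real.sin (k * t / 2) ^ 2 = Real.sin (k * |t| / 2) ^ 2 := by
      rcases abs_choice t with h | h
      · rw [h]
      · rw [h]
        have : (k : ℝ) * -t / 2 = -(k * t / 2) := by ring
        rw [this, Real.sin_neg, neg_sq]
    rw [h1]
    have h2 := Real.mul_le_sin (x := k * |t| / 2) (by positivity) (by linarith)
    have h3 : 2 / Real.pi * (k * |t| / 2) = k * |t| / Real.pi := by field_simp
    rw [h3] at h2
    gcongr
  by_cases h : N * |t| ≤ Real.pi
  · refine ⟨N, le_rfl, le_trans ?_ (jordan N h)⟩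
    have : (N * t) ^ 2 = (N * |t|) ^ 2 := by rw [mul_pow, mul_pow, sq_abs]
    rw [this, div_pow]
    calc 1 / 16 * min 1 ((N * |t|) ^ 2) ≤ 1 / 16 * (N * |t|) ^ 2 := by gcongr; exact min_le_right _ _
      _ ≤ _ := by
        rw [one_div_mul_eq_div]
        gcongr
        nlinarith
  · push Not at h
    have ht0 : 0 < |t| := by
      rcases (abs_nonneg t).eq_or_lt with h0 | h0
      · rw [← h0] at h; simp at h; linarith
      · exact h0
    have q1 : 1 ≤ Real.pi / |t| := by rwa [le_div_iff₀ ht0, one_mul]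
    have f1 : (⌊Real.pi / |t|⌋₊ : ℝ) ≤ Real.pi / |t| := Nat.floor_le (by positivity)
    have f2 := Nat.lt_floor_add_one (Real.pi / |t|)
    have f3 : 1 ≤ ⌊Real.pi / |t|⌋₊ := Nat.le_floor (by simpa using q1)
    have f3' : (1 : ℝ) ≤ (⌊Real.pi / |t|⌋₊ : ℝ) := by exact_mod_cast f3
    refine ⟨⌊Real.pi / |t|⌋₊, ?_, ?_⟩
    · apply Nat.floor_le_of_le
      rw [div_le_iff₀ ht0]; exact h.le
    · refine le_trans ?_ (jordan _ ?_)
      · have g : 1 / 2 ≤ (⌊Real.pi / |t|⌋₊ : ℝ) * |t| / Real.pi := by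
          have : Real.pi / |t| ≤ 2 * (⌊Real.pi / |t|⌋₊ : ℝ) := by linarith
          rw [div_le_iff₀ ht0] at this
          rw [le_div_iff₀ hpi]; linarith
        have g2 : (1 / 2 : ℝ) ^ 2 ≤ ((⌊Real.pi / |t|⌋₊ : ℝ) * |t| / Real.pi) ^ 2 := by gcongr
        have := min_le_left 1 ((N * t) ^ 2)
        linarith
      · rwa [le_div_iff₀ ht0] at f1

lemma sin_sum_lower (N : ℕ) (hN : 1 ≤ N) (t : ℝ) (ht : |t| ≤ Real.pi) :
    (N : ℝ) / 64 * min 1 ((N * t) ^ 2) ≤ ∑ j ∈ Finset.Ioc N (3 * N), Real.sin (j * t / 2) ^ 2 := by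
  obtain ⟨k, hk, h⟩ := exists_sin_large N hN t ht
  have h1 : ∑ j ∈ Finset.Ioc N (2 * N), Real.sin (j * t / 2) ^ 2 ≤
      ∑ j ∈ Finset.Ioc N (3 * N), Real.sin (j * t / 2) ^ 2 := by
    apply Finset.sum_le_sum_of_subset_of_nonneg
    · apply Finset.Ioc_subset_Ioc_right; omega
    · intros; positivity
  have h2 : ∑ j ∈ Finset.Ioc N (2 * N), Real.sin ((j + k : ℕ) * t / 2) ^ 2 ≤
      ∑ j ∈ Finset.Ioc N (3 * N), Real.sin (j * t / 2) ^ 2 := by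
    rw [← Finset.sum_image (s := Finset.Ioc N (2 * N)) (g := fun j => j + k) (f := fun j : ℕ => Real.sin (j * t / 2) ^ 2)]
    · apply Finset.sum_le_sum_of_subset_of_nonneg
      · intro j hj
        simp only [Finset.mem_image, Finset.mem_Ioc] at hj ⊢
        obtain ⟨i, hi, rfl⟩ := hj
        omega
      · intros; positivity
    · intro i _ j _ hij
      simpa using hij
  have h3 : ∑ j ∈ Finset.Ioc N (2 * N), Real.sin (k * t / 2) ^ 2 ≤
      ∑ j ∈ Finset.Ioc N (2 * N), 2 * (Real.sin (j * t / 2) ^ 2 + Real.sin ((j + k : ℕ) * t / 2) ^ 2) := by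
    apply Finset.sum_le_sum
    intro j _
    have := sin_sq_pair (j * t / 2) (k * t / 2)
    have e : (j : ℝ) * t / 2 + k * t / 2 = (j + k : ℕ) * t / 2 := by push_cast; ring
    rwa [e] at this
  rw [← Finset.mul_sum, Finset.sum_add_distrib, Finset.sum_const, Nat.card_Ioc, nsmul_eq_mul] at h3
  have h4 : ((2 * N - N : ℕ) : ℝ) = N := by congr 1; omega
  rw [h4] at h3
  have h5 : (N : ℝ) * (1 / 16 * min 1 ((N * t) ^ 2)) ≤ N * Real.sin (k * t / 2) ^ 2 := by gcongr
  linarith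
section CoeffPart
open Polynomial

lemma trunc_rec (a n : ℕ) :
    (1 - X : ℂ[X]) * ∑ k ∈ Finset.range (n + 1), C ((Nat.choose (a + 1 + k - 1) k : ℕ) : ℂ) * X ^ k =
      ∑ k ∈ Finset.range (n + 1), C ((Nat.choose (a + k - 1) k : ℕ) : ℂ) * X ^ k
        - C ((Nat.choose (a + n) n : ℕ) : ℂ) * X ^ (n + 1) := by
  induction n with
  | zero => simp
  | succ n ih =>
    rw [Finset.sum_range_succ, mul_add, ih, Finset.sum_range_succ _ (n + 1)]
    have h1 : a + 1 + (n + 1) - 1 = a + n + 1 := by omega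
    have h2 : a + (n + 1) - 1 = a + n := by omega
    have h3 : a + (n + 1) = a + n + 1 := by omega
    rw [h1, h2, h3, Nat.choose_succ_succ]
    push_cast
    simp only [map_add]
    ring

lemma trunc_exists (a n : ℕ) : (X : ℂ[X]) ^ (n + 1) ∣
    (1 - X : ℂ[X]) ^ a * ∑ k ∈ Finset.range (n + 1), C ((Nat.choose (a + k - 1) k : ℕ) : ℂ) * X ^ k - 1 := by
  induction a with
  | zero =>
    have : ∑ k ∈ Finset.range (n + 1), C ((Nat.choose (0 + k - 1) k : ℕ) : ℂ) * X ^ k = (1 : ℂ[X]) := by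
      rw [Finset.sum_range_succ']
      have : ∀ k ∈ Finset.range n, C ((Nat.choose (0 + (k + 1) - 1) (k + 1) : ℕ) : ℂ) * X ^ (k + 1) = (0 : ℂ[X]) := by
        intro k _
        rw [Nat.choose_eq_zero_of_lt (by omega)]; simp
      rw [Finset.sum_eq_zero this]; simp
    rw [this]; simp
  | succ a ih =>
    rw [pow_succ (1 - X : ℂ[X]), mul_assoc, trunc_rec, mul_sub]
    have : (1 - X : ℂ[X]) ^ a * ∑ k ∈ Finset.range (n + 1), C ((Nat.choose (a + k - 1) k : ℕ) : ℂ) * X ^ k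
        - (1 - X) ^ a * (C ((Nat.choose (a + n) n : ℕ) : ℂ) * X ^ (n + 1)) - 1 =
      ((1 - X : ℂ[X]) ^ a * ∑ k ∈ Finset.range (n + 1), C ((Nat.choose (a + k - 1) k : ℕ) : ℂ) * X ^ k - 1)
        - X ^ (n + 1) * ((1 - X) ^ a * (C ((Nat.choose (a + n) n : ℕ) : ℂ))) := by ring
    rw [this]
    exact dvd_sub ih (dvd_mul_right _ _)

lemma trunc_exists_comp (a n j : ℕ) (hj : 1 ≤ j) : (X : ℂ[X]) ^ (n + 1) ∣
    (1 - X ^ j : ℂ[X]) ^ a * (∑ k ∈ Finset.range (n + 1), C ((Nat.choose (a + k - 1) k : ℕ) : ℂ) * X ^ (j * k)) - 1 := by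
  obtain ⟨Q, hQ⟩ := trunc_exists a n
  have := congrArg (fun p : ℂ[X] => p.comp (X ^ j)) hQ
  simp only [sub_comp, mul_comp, pow_comp, one_comp, X_comp, Polynomial.sum_comp, C_comp] at this
  simp only [pow_mul]
  rw [this, ← pow_mul]
  exact (pow_dvd_pow X (by nlinarith)).trans (dvd_mul_right _ _)

noncomputable def multPoly (a : ℕ → ℕ) (n : ℕ) : ℂ[X] :=
  ∏ j : Fin n, ∑ k : Fin (n + 1), C ((Nat.choose (a (j.1 + 1) + k.1 - 1) k.1 : ℕ) : ℂ) * X ^ ((j.1 + 1) * k.1)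

lemma multPoly_coeff (a : ℕ → ℕ) (n : ℕ) : (multPoly a n).coeff n = (multisetCount a n : ℂ) := by
  unfold multPoly multisetCount
  rw [Finset.prod_univ_sum, Fintype.piFinset_univ, finsetSum_coeff]
  push_cast
  apply Finset.sum_congr rfl
  intro η _
  rw [Finset.prod_mul_distrib, Finset.prod_pow_eq_pow_sum, ← map_prod, coeff_C_mul, coeff_X_pow]
  by_cases h : ∑ j : Fin n, (j.1 + 1) * (η j).1 = n
  · rw [if_pos h, if_pos h.symm]; simp
  · rw [if_neg h, if_neg (fun h' => h h'.symm)]; simp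

noncomputable def denPoly (a : ℕ → ℕ) (n : ℕ) : ℂ[X] := ∏ j : Fin n, (1 - X ^ (j.1 + 1)) ^ (a (j.1 + 1))

lemma den_mul_mult (a : ℕ → ℕ) (n : ℕ) : (X : ℂ[X]) ^ (n + 1) ∣ denPoly a n * multPoly a n - 1 := by
  unfold denPoly multPoly
  rw [← Finset.prod_mul_distrib]
  apply Finset.prod_induction _ (fun f : ℂ[X] => (X : ℂ[X]) ^ (n + 1) ∣ f - 1)
  · intro f g hf hg
    have : f * g - 1 = f * (g - 1) + (f - 1) := by ring
    rw [this]
    exact dvd_add (dvd_mul_of_dvd_right hg _) hf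
  · simp
  · intro j _
    have := trunc_exists_comp (a (j.1 + 1)) n (j.1 + 1) (by omega)
    rwa [Finset.sum_range] at this

lemma denPoly_eval (a : ℕ → ℕ) (n : ℕ) (z : ℂ) :
    (denPoly a n).eval z = ∏ j ∈ Finset.Icc 1 n, (1 - z ^ j) ^ (a j) := by
  unfold denPoly
  rw [eval_prod]
  have h : ∀ f : ℕ → ℂ, ∏ j ∈ Finset.Icc 1 n, f j = ∏ j : Fin n, f (j.1 + 1) := by
    intro f
    rw [← Finset.prod_range (fun i => f (i + 1))]
    rw [Finset.range_eq_Ico, Finset.prod_Ico_add']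
    rfl
  rw [h]
  simp

lemma denPoly_ne_zero (a : ℕ → ℕ) (n : ℕ) (z : ℂ) (hz : ‖z‖ < 1) : (denPoly a n).eval z ≠ 0 := by
  rw [denPoly_eval]
  rw [Finset.prod_ne_zero_iff]
  intro j hj
  apply pow_ne_zero
  intro h
  have h1 : z ^ j = 1 := (sub_eq_zero.1 h).symm
  have h2 : ‖z‖ ^ j < 1 := pow_lt_one₀ (norm_nonneg _) hz (by have := (Finset.mem_Icc.1 hj).1; omega)
  rw [← norm_pow, h1] at h2
  simp at h2

lemma circle_poly (P : ℂ[X]) (n : ℕ) (ρ : ℝ) (hρ : 0 < ρ) :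
    (∮ z in C(0, ρ), P.eval z * z ^ (-(n + 1 : ℤ))) = 2 * Real.pi * Complex.I * P.coeff n := by
  have e : ∀ z ∈ Metric.sphere (0 : ℂ) ρ, P.eval z * z ^ (-(n + 1 : ℤ)) =
      ∑ k ∈ Finset.range (max (P.natDegree) n + 1), P.coeff k * (z - 0) ^ ((k : ℤ) - n - 1) := by
    intro z hz
    have hz0 : z ≠ 0 := by
      rintro rfl
      simp at hz
      linarith
    rw [eval_eq_sum_range' (n := max (P.natDegree) n + 1) (by omega), Finset.sum_mul]
    apply Finset.sum_congr rfl
    intro k _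
    rw [sub_zero, mul_assoc, ← zpow_natCast z k, ← zpow_add₀ hz0]
    congr 2
    ring
  rw [circleIntegral.integral_congr hρ.le e, circleIntegral.integral_fun_sum]
  · rw [Finset.sum_eq_single n]
    · rw [circleIntegral.integral_const_mul]
      have : ∀ z : ℂ, (z - 0) ^ ((n : ℤ) - n - 1) = (z - 0)⁻¹ := by
        intro z
        have : (n : ℤ) - n - 1 = -1 := by ring
        rw [this, zpow_neg_one]
      simp only [this]
      rw [circleIntegral.integral_sub_center_inv 0 hρ.ne']
      ring
    · intro k _ hk
      rw [circleIntegral.integral_const_mul, circleIntegral.integral_sub_zpow_of_ne (by omega), mul_zero]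
    · intro h
      exact absurd (Finset.mem_range.2 (by omega)) h
  · intro k _
    apply CircleIntegrable.const_smul (a := P.coeff k) (f := fun z : ℂ => (z - 0) ^ ((k : ℤ) - n - 1))
    rw [circleIntegrable_sub_zpow_iff]
    right; right
    simp
    exact (abs_pos.2 hρ.ne').ne

lemma coeff_integral (a : ℕ → ℕ) (n : ℕ) (ρ : ℝ) (hρ : 0 < ρ) (hρ1 : ρ < 1) :
    (multisetCount a n : ℂ) * ρ ^ n * (2 * Real.pi) =
      ∫ t in (-Real.pi)..Real.pi,
        (∏ j ∈ Finset.Icc 1 n, (1 - ((ρ : ℂ) * Complex.exp (t * Complex.I)) ^ j) ^ (a j))⁻¹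
          * Complex.exp (-(n * t * Complex.I)) := by
  obtain ⟨Q, hQ⟩ := den_mul_mult a n
  set g : ℝ → ℂ := fun t => (∏ j ∈ Finset.Icc 1 n, (1 - ((ρ : ℂ) * Complex.exp (t * Complex.I)) ^ j) ^ (a j))⁻¹
          * Complex.exp (-(n * t * Complex.I)) with hg
  have hper : Function.Periodic g (2 * Real.pi) := by
    intro t
    simp only [hg]
    have h1 : Complex.exp ((t + 2 * Real.pi : ℝ) * Complex.I) = Complex.exp (t * Complex.I) := by
      push_cast
      rw [add_mul, Complex.exp_add, Complex.exp_two_pi_mul_I, mul_one]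
    have h2 : ∀ s : ℝ, Complex.exp (-(n * s * Complex.I)) = (Complex.exp (s * Complex.I) ^ n)⁻¹ := by
      intro s
      rw [Complex.exp_neg, ← Complex.exp_nat_mul]; congr 2; ring
    rw [h2, h2, h1]
  have hsw : ∫ t in (-Real.pi)..Real.pi, g t = ∫ t in (0 : ℝ)..(2 * Real.pi), g t := by
    have := hper.intervalIntegral_add_eq (-Real.pi) 0
    rw [zero_add] at this
    rw [← this]; congr 1; ring
  have hball : ∀ z ∈ Metric.closedBall (0 : ℂ) ρ, (denPoly a n).eval z ≠ 0 := by
    intro z hz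
    apply denPoly_ne_zero
    have : ‖z‖ ≤ ρ := by simpa using hz
    linarith
  have hcont : ContinuousOn (fun z => Q.eval z / (denPoly a n).eval z) (Metric.closedBall (0 : ℂ) ρ) :=
    Q.continuous.continuousOn.div (denPoly a n).continuous.continuousOn hball
  have hQ0 : (∮ z in C(0, ρ), Q.eval z / (denPoly a n).eval z) = 0 := by
    apply Complex.circleIntegral_eq_zero_of_differentiable_on_off_countable hρ.le Set.countable_empty hcont
    intro z hz
    exact Q.differentiableAt.div (denPoly a n).differentiableAt (hball z (Metric.ball_subset_closedBall hz.1))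
  have hz0 : ∀ z ∈ Metric.sphere (0 : ℂ) ρ, z ≠ 0 := by
    rintro z hz rfl
    simp at hz
    linarith
  have hP : ContinuousOn (fun z => (multPoly a n).eval z * z ^ (-(n + 1 : ℤ))) (Metric.sphere (0 : ℂ) ρ) := by
    apply (multPoly a n).continuous.continuousOn.mul
    intro z hz
    exact (continuousAt_zpow₀ z _ (Or.inl (hz0 z hz))).continuousWithinAt
  have h1 : (∮ z in C(0, ρ), ((denPoly a n).eval z)⁻¹ * z ^ (-(n + 1 : ℤ))) =
      2 * Real.pi * Complex.I * (multisetCount a n : ℂ) := by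
    rw [← multPoly_coeff, ← circle_poly _ n ρ hρ]
    have hsub : (∮ z in C(0, ρ), (multPoly a n).eval z * z ^ (-(n + 1 : ℤ))) =
        (∮ z in C(0, ρ), (multPoly a n).eval z * z ^ (-(n + 1 : ℤ))) -
          (∮ z in C(0, ρ), Q.eval z / (denPoly a n).eval z) := by rw [hQ0, sub_zero]
    rw [hsub, ← circleIntegral.integral_sub]
    · apply circleIntegral.integral_congr hρ.le
      intro z hz
      have hd := hball z (Metric.sphere_subset_closedBall hz)
      have hz' := hz0 z hz
      have := congrArg (Polynomial.eval z) hQ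
      simp only [eval_sub, eval_mul, eval_one, eval_pow, eval_X] at this
      have e : z ^ (-(n + 1 : ℤ)) = (z ^ (n + 1))⁻¹ := by
        rw [zpow_neg]; norm_cast
      simp only [e]
      have hzn : z ^ (n + 1) ≠ 0 := pow_ne_zero _ hz'
      field_simp
      linear_combination -this
    · exact hP.circleIntegrable hρ.le
    · exact (hcont.mono Metric.sphere_subset_closedBall).circleIntegrable hρ.le
  rw [hsw]
  have h2 : (∮ z in C(0, ρ), ((denPoly a n).eval z)⁻¹ * z ^ (-(n + 1 : ℤ))) =
      Complex.I * ((ρ : ℂ) ^ n)⁻¹ * ∫ t in (0 : ℝ)..(2 * Real.pi), g t := by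
    rw [circleIntegral, ← intervalIntegral.integral_const_mul]
    congr 1
    funext t
    have hρc : (ρ : ℂ) ≠ 0 := by exact_mod_cast hρ.ne'
    have he := Complex.exp_ne_zero (t * Complex.I)
    have h3 : circleMap 0 ρ t = ρ * Complex.exp (t * Complex.I) := by simp [circleMap]
    have h4 : Complex.exp (-(n * t * Complex.I)) = (Complex.exp (t * Complex.I) ^ n)⁻¹ := by
      rw [Complex.exp_neg, ← Complex.exp_nat_mul]; congr 2; ring
    rw [deriv_circleMap, h3, denPoly_eval, smul_eq_mul]
    simp only [hg]
    rw [h4]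
    have e : (ρ * Complex.exp (t * Complex.I)) ^ (-(n + 1 : ℤ)) =
        ((ρ * Complex.exp (t * Complex.I)) ^ (n + 1))⁻¹ := by
      rw [zpow_neg]; norm_cast
    rw [e, mul_pow, pow_succ, pow_succ]
    generalize (∏ j ∈ Finset.Icc 1 n, (1 - (ρ * Complex.exp (t * Complex.I)) ^ j) ^ a j)⁻¹ = D
    field_simp
  rw [h1] at h2
  have hρc : (ρ : ℂ) ^ n ≠ 0 := pow_ne_zero _ (by exact_mod_cast hρ.ne')
  have h3 : Complex.I * ((multisetCount a n : ℂ) * ρ ^ n * (2 * Real.pi)) =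
      Complex.I * ∫ t in (0 : ℝ)..(2 * Real.pi), g t := by
    rw [show Complex.I * ((multisetCount a n : ℂ) * ρ ^ n * (2 * Real.pi)) =
      (2 * Real.pi * Complex.I * (multisetCount a n : ℂ)) * ρ ^ n by ring, h2]
    field_simp
  exact mul_left_cancel₀ Complex.I_ne_zero h3

end CoeffPart
lemma pow_mul_exp_eq (y σ : ℝ) (hy : 1 ≤ y) (j : ℕ) :
    y ^ j * Real.exp (-(j * σ)) = Real.exp (-(j * (σ - Real.log y))) := by
  have hy0 : 0 < y := by linarith
  have : y ^ j = Real.exp (j * Real.log y) := by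
    rw [Real.exp_nat_mul, Real.exp_log hy0]
  rw [this, ← Real.exp_add]; congr 1; ring

lemma upper_sum (a : ℕ → ℕ) (r y D₂ : ℝ) (hr : 0 < r) (hy : 1 ≤ y) (hD : 0 < D₂)
    (ha : ∀ j : ℕ, 1 ≤ j → (a j : ℝ) ≤ D₂ * (j : ℝ) ^ (r - 1) * y ^ j) (k : ℕ) :
    ∃ C : ℝ, 0 < C ∧ ∀ (n : ℕ) (σ : ℝ), 0 < σ - Real.log y →
      ∑ j ∈ Finset.Icc 1 n, (j : ℝ) ^ k * (a j) * Real.exp (-(j * σ)) / (1 - Real.exp (-(j * σ))) ^ k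
        ≤ C * (σ - Real.log y) ^ (-(k + r)) := by
  obtain ⟨C, hC, h⟩ := sum_pow_exp r hr
  set A : ℝ := k.factorial / (1 / 2) ^ k * Real.exp (1 / 2) with hA
  have hA0 : 0 < A := by positivity
  have hA1 : ∀ u : ℝ, 0 ≤ u → (1 + u) ^ k ≤ A * Real.exp (u / 2) := by
    intro u hu
    have h3 := Real.pow_div_factorial_le_exp (1 / 2 * (1 + u)) (by positivity) k
    rw [div_le_iff₀ (by positivity), mul_pow] at h3
    have e : Real.exp (1 / 2 * (1 + u)) = Real.exp (1 / 2) * Real.exp (u / 2) := by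
      rw [← Real.exp_add]; congr 1; ring
    rw [e] at h3
    rw [hA, div_mul_eq_mul_div, div_mul_eq_mul_div, le_div_iff₀ (by positivity)]
    linarith
  refine ⟨D₂ * A * C * (1 / 2) ^ (-r), by positivity, fun n σ hσ => ?_⟩
  set δ := σ - Real.log y with hδ
  have hly : 0 ≤ Real.log y := Real.log_nonneg hy
  have hterm : ∀ j ∈ Finset.Icc 1 n,
      (j : ℝ) ^ k * (a j) * Real.exp (-(j * σ)) / (1 - Real.exp (-(j * σ))) ^ k ≤
      D₂ * A * δ ^ (-(k : ℝ)) * ((j : ℝ) ^ (r - 1) * Real.exp (-(j * (δ / 2)))) := by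
    intro j hj
    have hj1 := (Finset.mem_Icc.1 hj).1
    have hj0 : (0 : ℝ) < j := by exact_mod_cast hj1
    have h1 : (a j : ℝ) * Real.exp (-(j * σ)) ≤ D₂ * (j : ℝ) ^ (r - 1) * Real.exp (-(j * δ)) := by
      rw [hδ, ← pow_mul_exp_eq y σ hy j, ← mul_assoc]
      exact mul_le_mul_of_nonneg_right (ha j hj1) (Real.exp_pos _).le
    have h2 : j * δ / (1 + j * δ) ≤ 1 - Real.exp (-(j * σ)) := by
      refine (one_sub_exp_lower (j * δ) (by positivity)).trans ?_
      have : Real.exp (-(j * σ)) ≤ Real.exp (-(j * δ)) := by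
        apply Real.exp_le_exp.2
        have : j * δ ≤ j * σ := by gcongr; linarith
        linarith
      linarith
    have h3 : (j : ℝ) / (1 - Real.exp (-(j * σ))) ≤ (1 + j * δ) / δ := by
      have h4 : 0 < j * δ / (1 + j * δ) := by positivity
      calc (j : ℝ) / (1 - Real.exp (-(j * σ))) ≤ j / (j * δ / (1 + j * δ)) := by gcongr
        _ = _ := by field_simp
    have h4 : 0 < 1 - Real.exp (-(j * σ)) := lt_of_lt_of_le (by positivity) h2
    calc (j : ℝ) ^ k * (a j) * Real.exp (-(j * σ)) / (1 - Real.exp (-(j * σ))) ^ k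
        = (a j * Real.exp (-(j * σ))) * (j / (1 - Real.exp (-(j * σ)))) ^ k := by
          rw [div_pow]; ring
      _ ≤ (D₂ * (j : ℝ) ^ (r - 1) * Real.exp (-(j * δ))) * ((1 + j * δ) / δ) ^ k := by gcongr
      _ = (D₂ * (j : ℝ) ^ (r - 1) * Real.exp (-(j * δ))) * ((1 + j * δ) ^ k * δ ^ (-(k : ℝ))) := by
          rw [div_pow, Real.rpow_neg hσ.le, Real.rpow_natCast]; rfl
      _ ≤ (D₂ * (j : ℝ) ^ (r - 1) * Real.exp (-(j * δ))) * (A * Real.exp (j * δ / 2) * δ ^ (-(k : ℝ))) := by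
          gcongr
          exact hA1 _ (by positivity)
      _ = _ := by
          have : Real.exp (-(j * (δ / 2))) = Real.exp (-(j * δ)) * Real.exp (j * δ / 2) := by
            rw [← Real.exp_add]; congr 1; ring
          rw [this]; ring
  refine (Finset.sum_le_sum hterm).trans ?_
  rw [← Finset.mul_sum]
  have h5 := h (δ / 2) (by positivity) n
  calc D₂ * A * δ ^ (-(k : ℝ)) * ∑ j ∈ Finset.Icc 1 n, (j : ℝ) ^ (r - 1) * Real.exp (-(j * (δ / 2)))
      ≤ D₂ * A * δ ^ (-(k : ℝ)) * (C * (δ / 2) ^ (-r)) := by gcongr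
    _ = _ := by
      have e1 : (δ / 2) ^ (-r) = (1 / 2) ^ (-r) * δ ^ (-r) := by
        rw [← Real.mul_rpow (by norm_num) hσ.le]; congr 1; ring
      rw [e1, neg_add, Real.rpow_add hσ]; ring

lemma M_lower (a : ℕ → ℕ) (r y D₁ σ : ℝ) (hr : 0 < r) (hy : 1 ≤ y) (hD : 0 < D₁)
    (ha : ∀ j : ℕ, 1 ≤ j → D₁ * (j : ℝ) ^ (r - 1) * y ^ j ≤ (a j : ℝ)) (n : ℕ) (hσ : 0 < σ)
    (K : ℝ) (hK : 0 ≤ K) (hn : 1 ≤ n) (hle : n * (σ - Real.log y) ≤ K) :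
    D₁ * Real.exp (-K) * ((n / 2 : ℝ) * (n / 2 : ℝ) ^ r) ≤ Mfun a n σ := by
  unfold Mfun
  set δ := σ - Real.log y with hδ
  have hn0 : (0 : ℝ) < n := by exact_mod_cast hn
  have hterm : ∀ j ∈ Finset.Icc 1 n, D₁ * Real.exp (-K) * (j : ℝ) ^ r ≤
      (j : ℝ) * (a j) * Real.exp (-(j * σ)) / (1 - Real.exp (-(j * σ))) := by
    intro j hj
    have hj1 := (Finset.mem_Icc.1 hj).1
    have hjn : (j : ℝ) ≤ n := by exact_mod_cast (Finset.mem_Icc.1 hj).2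
    have hj0 : (0 : ℝ) < j := by exact_mod_cast hj1
    have hx : Real.exp (-(j * σ)) < 1 := by
      rw [Real.exp_lt_one_iff]
      have : 0 < j * σ := by positivity
      linarith
    have h1 : D₁ * (j : ℝ) ^ (r - 1) * Real.exp (-(j * δ)) ≤ (a j : ℝ) * Real.exp (-(j * σ)) := by
      rw [hδ, ← pow_mul_exp_eq y σ hy j, ← mul_assoc]
      exact mul_le_mul_of_nonneg_right (ha j hj1) (Real.exp_pos _).le
    have h2 : j * δ ≤ K := by
      rcases le_or_gt δ 0 with h | h
      · nlinarith
      · nlinarith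
    have h3 : (j : ℝ) ^ r = j * (j : ℝ) ^ (r - 1) := by
      rw [Real.rpow_sub_one hj0.ne']; field_simp
    rw [le_div_iff₀ (by linarith)]
    calc D₁ * Real.exp (-K) * (j : ℝ) ^ r * (1 - Real.exp (-(j * σ)))
        ≤ D₁ * Real.exp (-(j * δ)) * (j : ℝ) ^ r * 1 := by
          gcongr
          linarith [Real.exp_pos (-(j * σ))]
      _ = j * (D₁ * (j : ℝ) ^ (r - 1) * Real.exp (-(j * δ))) := by rw [h3]; ring
      _ ≤ j * ((a j : ℝ) * Real.exp (-(j * σ))) := by gcongr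
      _ = _ := by ring
  refine le_trans ?_ (Finset.sum_le_sum hterm)
  rw [← Finset.mul_sum]
  gcongr
  have h4 : ∑ j ∈ Finset.Ioc (n / 2) n, (n / 2 : ℝ) ^ r ≤ ∑ j ∈ Finset.Icc 1 n, (j : ℝ) ^ r := by
    calc ∑ j ∈ Finset.Ioc (n / 2) n, (n / 2 : ℝ) ^ r ≤ ∑ j ∈ Finset.Ioc (n / 2) n, (j : ℝ) ^ r := by
          apply Finset.sum_le_sum
          intro j hj
          have hj1 := (Finset.mem_Ioc.1 hj).1
          have : (n : ℝ) ≤ 2 * j := by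
            have : n ≤ 2 * j := by omega
            exact_mod_cast this
          apply Real.rpow_le_rpow (by positivity) (by linarith) hr.le
      _ ≤ _ := by
          apply Finset.sum_le_sum_of_subset_of_nonneg
          · intro j hj
            simp only [Finset.mem_Ioc, Finset.mem_Icc] at hj ⊢
            omega
          · intros; positivity
  refine le_trans ?_ h4
  rw [Finset.sum_const, Nat.card_Ioc, nsmul_eq_mul]
  gcongr
  have : (n : ℝ) ≤ 2 * ((n - n / 2 : ℕ) : ℝ) := by
    have : n ≤ 2 * (n - n / 2) := by omega
    exact_mod_cast this
  linarith

lemma ax_lower (a : ℕ → ℕ) (r y D₁ : ℝ) (hy : 1 ≤ y) (hD : 0 < D₁)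
    (ha : ∀ j : ℕ, 1 ≤ j → D₁ * (j : ℝ) ^ (r - 1) * y ^ j ≤ (a j : ℝ)) :
    ∃ c : ℝ, 0 < c ∧ ∀ σ : ℝ, 0 < σ - Real.log y → ∀ j : ℕ, 1 ≤ j * (σ - Real.log y) →
      j * (σ - Real.log y) ≤ 3 → c * (σ - Real.log y) ^ (1 - r) ≤ a j * Real.exp (-(j * σ)) := by
  refine ⟨D₁ * 3 ^ (-|r - 1|) * Real.exp (-3), by positivity, fun σ hσ j h1 h3 => ?_⟩
  set δ := σ - Real.log y with hδ
  have hj1 : 1 ≤ j := by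
    rcases Nat.eq_zero_or_pos j with h | h
    · rw [h] at h1; norm_num at h1
    · exact h
  have hj0 : (0 : ℝ) < j := by exact_mod_cast hj1
  have e1 : D₁ * (j : ℝ) ^ (r - 1) * Real.exp (-(j * δ)) ≤ (a j : ℝ) * Real.exp (-(j * σ)) := by
    rw [hδ, ← pow_mul_exp_eq y σ hy j, ← mul_assoc]
    exact mul_le_mul_of_nonneg_right (ha j hj1) (Real.exp_pos _).le
  refine le_trans ?_ e1
  have e2 : (j : ℝ) ^ (r - 1) = (j * δ) ^ (r - 1) * δ ^ (1 - r) := by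
    rw [Real.mul_rpow hj0.le hσ.le, mul_assoc, ← Real.rpow_add hσ]; simp
  have e3 : (3 : ℝ) ^ (-|r - 1|) ≤ (j * δ) ^ (r - 1) := by
    calc (3 : ℝ) ^ (-|r - 1|) ≤ (j * δ) ^ (-|r - 1|) :=
          Real.rpow_le_rpow_of_nonpos (by positivity) h3 (by simp)
      _ ≤ _ := Real.rpow_le_rpow_of_exponent_le h1 (neg_abs_le _)
  rw [e2]
  calc D₁ * 3 ^ (-|r - 1|) * Real.exp (-3) * δ ^ (1 - r)
      = D₁ * (3 ^ (-|r - 1|) * δ ^ (1 - r)) * Real.exp (-3) := by ring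
    _ ≤ _ := by gcongr

lemma floor_facts (δ : ℝ) (h0 : 0 < δ) (h1 : δ ≤ 1) (n : ℕ) (hn : 3 ≤ n * δ) :
    1 ≤ ⌊1 / δ⌋₊ ∧ 1 ≤ 2 * (⌊1 / δ⌋₊ : ℝ) * δ ∧
    ∀ j ∈ Finset.Ioc ⌊1 / δ⌋₊ (3 * ⌊1 / δ⌋₊), j ∈ Finset.Icc 1 n ∧ 1 ≤ j * δ ∧ j * δ ≤ 3 := by
  have f1 : (⌊1 / δ⌋₊ : ℝ) ≤ 1 / δ := Nat.floor_le (by positivity)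
  have f2 := Nat.lt_floor_add_one (1 / δ)
  have f3 : 1 ≤ ⌊1 / δ⌋₊ := Nat.le_floor (by rw [le_div_iff₀ h0]; simpa using h1)
  have f3' : (1 : ℝ) ≤ (⌊1 / δ⌋₊ : ℝ) := by exact_mod_cast f3
  set N := ⌊1 / δ⌋₊ with hN
  rw [le_div_iff₀ h0] at f1
  rw [div_lt_iff₀ h0] at f2
  refine ⟨f3, by nlinarith, fun j hj => ?_⟩
  obtain ⟨g1, g2⟩ := Finset.mem_Ioc.1 hj
  have g1' : (N : ℝ) + 1 ≤ j := by exact_mod_cast g1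
  have g2' : (j : ℝ) ≤ 3 * N := by exact_mod_cast g2
  have g3 : j * δ ≤ 3 := by nlinarith
  refine ⟨?_, by nlinarith, g3⟩
  rw [Finset.mem_Icc]
  refine ⟨by omega, ?_⟩
  have : (j : ℝ) ≤ n := le_of_mul_le_mul_right (g3.trans hn) h0
  exact_mod_cast this

lemma B2_lower (a : ℕ → ℕ) (r y D₁ : ℝ) (hy : 1 ≤ y) (hD : 0 < D₁)
    (ha : ∀ j : ℕ, 1 ≤ j → D₁ * (j : ℝ) ^ (r - 1) * y ^ j ≤ (a j : ℝ)) :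
    ∃ c : ℝ, 0 < c ∧ ∀ (σ : ℝ) (n : ℕ), 0 < σ - Real.log y → σ - Real.log y ≤ 1 →
      3 ≤ n * (σ - Real.log y) → c * (σ - Real.log y) ^ (-(2 + r)) ≤ B2 a n σ := by
  obtain ⟨c, hc, h⟩ := ax_lower a r y D₁ hy hD ha
  refine ⟨c, hc, fun σ n h0 h1 hn => ?_⟩
  have hly : 0 ≤ Real.log y := Real.log_nonneg hy
  set δ := σ - Real.log y with hδ
  obtain ⟨f1, f2, f3⟩ := floor_facts δ h0 h1 n hn
  set N := ⌊1 / δ⌋₊ with hN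
  have hx : ∀ j ∈ Finset.Icc 1 n, 0 < Real.exp (-(j * σ)) ∧ Real.exp (-(j * σ)) < 1 := by
    intro j hj
    have hj1 := (Finset.mem_Icc.1 hj).1
    have hj0 : (0 : ℝ) < j := by exact_mod_cast hj1
    refine ⟨Real.exp_pos _, ?_⟩
    rw [Real.exp_lt_one_iff]
    have : 0 < j * σ := mul_pos hj0 (by linarith)
    linarith
  unfold B2
  calc c * δ ^ (-(2 + r)) ≤ ∑ j ∈ Finset.Ioc N (3 * N), (1 / δ) ^ 2 * (c * δ ^ (1 - r)) := by
        rw [Finset.sum_const, Nat.card_Ioc, nsmul_eq_mul]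
        have e : ((3 * N - N : ℕ) : ℝ) = 2 * N := by
          rw [show 3 * N - N = 2 * N by omega]; push_cast; ring
        rw [e]
        have e2 : δ ^ (-(2 + r)) = δ ^ (1 - r) * (1 / δ) ^ 2 * (1 / δ) := by
          rw [show -(2 + r) = (1 - r) + (-3 : ℤ) by push_cast; ring, Real.rpow_add h0, Real.rpow_intCast]
          rw [zpow_neg]
          field_simp
        rw [e2]
        have e3 : 1 / δ ≤ 2 * N := by rw [div_le_iff₀ h0]; exact f2
        calc c * (δ ^ (1 - r) * (1 / δ) ^ 2 * (1 / δ)) ≤ c * (δ ^ (1 - r) * (1 / δ) ^ 2 * (2 * N)) := by gcongr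
          _ = _ := by ring
    _ ≤ ∑ j ∈ Finset.Ioc N (3 * N), (j : ℝ) ^ 2 * (a j) * Real.exp (-(j * σ)) / (1 - Real.exp (-(j * σ))) ^ 2 := by
        apply Finset.sum_le_sum
        intro j hj
        obtain ⟨g1, g2, g3⟩ := f3 j hj
        obtain ⟨x1, x2⟩ := hx j g1
        have k1 := h σ h0 j g2 g3
        have k2 : 1 / δ ≤ j := by rw [div_le_iff₀ h0]; exact g2
        have k3 : 0 < (1 - Real.exp (-(j * σ))) ^ 2 := by
          have : 0 < 1 - Real.exp (-(j * σ)) := by linarith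
          positivity
        rw [le_div_iff₀ k3]
        calc (1 / δ) ^ 2 * (c * δ ^ (1 - r)) * (1 - Real.exp (-(j * σ))) ^ 2
            ≤ (j : ℝ) ^ 2 * (a j * Real.exp (-(j * σ))) * 1 := by
              gcongr
              apply pow_le_one₀ <;> linarith
          _ = _ := by ring
    _ ≤ _ := by
        apply Finset.sum_le_sum_of_subset_of_nonneg
        · intro j hj; exact (f3 j hj).1
        · intro j _ _; positivity

lemma E_lower (a : ℕ → ℕ) (r y D₁ : ℝ) (hy : 1 ≤ y) (hD : 0 < D₁)
    (ha : ∀ j : ℕ, 1 ≤ j → D₁ * (j : ℝ) ^ (r - 1) * y ^ j ≤ (a j : ℝ)) :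
    ∃ c : ℝ, 0 < c ∧ ∀ (σ : ℝ) (n : ℕ), 0 < σ - Real.log y → σ - Real.log y ≤ 1 →
      3 ≤ n * (σ - Real.log y) → ∀ t : ℝ, |t| ≤ Real.pi →
      c * (σ - Real.log y) ^ (-r) * min 1 ((t / (σ - Real.log y)) ^ 2) ≤
        ∑ j ∈ Finset.Icc 1 n, a j * (Real.exp (-(j * σ)) * Real.sin (j * t / 2) ^ 2) := by
  obtain ⟨c, hc, h⟩ := ax_lower a r y D₁ hy hD ha
  refine ⟨c / 512, by positivity, fun σ n h0 h1 hn t ht => ?_⟩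
  set δ := σ - Real.log y with hδ
  obtain ⟨f1, f2, f3⟩ := floor_facts δ h0 h1 n hn
  set N := ⌊1 / δ⌋₊ with hN
  have e3 : 1 / δ ≤ 2 * N := by rw [div_le_iff₀ h0]; exact f2
  have hN0 : (0 : ℝ) < N := by exact_mod_cast f1
  calc c / 512 * δ ^ (-r) * min 1 ((t / δ) ^ 2)
      ≤ c * δ ^ (1 - r) * (N / 64 * min 1 ((N * t) ^ 2)) := by
        have e1 : δ ^ (-r) = δ ^ (1 - r) * (1 / δ) := by
          rw [show -r = (1 - r) + (-1) by ring, Real.rpow_add h0, Real.rpow_neg_one, one_div]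
        have e2 : min 1 ((t / δ) ^ 2) ≤ 4 * min 1 ((N * t) ^ 2) := by
          have k1 : (t / δ) ^ 2 ≤ 4 * (N * t) ^ 2 := by
            have : (t / δ) ^ 2 = t ^ 2 * (1 / δ) ^ 2 := by rw [div_pow, div_pow]; ring
            rw [this]
            calc t ^ 2 * (1 / δ) ^ 2 ≤ t ^ 2 * (2 * N) ^ 2 := by gcongr
              _ = _ := by ring
          rcases le_total 1 ((N * t) ^ 2) with h | h
          · rw [min_eq_left h]; linarith [min_le_left 1 ((t / δ) ^ 2)]
          · rw [min_eq_right h]; linarith [min_le_right 1 ((t / δ) ^ 2)]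
        rw [e1]
        have hm : 0 ≤ min 1 ((t / δ) ^ 2) := le_min zero_le_one (sq_nonneg _)
        calc c / 512 * (δ ^ (1 - r) * (1 / δ)) * min 1 ((t / δ) ^ 2)
            ≤ c / 512 * (δ ^ (1 - r) * (2 * N)) * (4 * min 1 ((N * t) ^ 2)) := by gcongr
          _ = _ := by ring
    _ ≤ c * δ ^ (1 - r) * ∑ j ∈ Finset.Ioc N (3 * N), Real.sin (j * t / 2) ^ 2 := by
        gcongr
        exact sin_sum_lower N f1 t ht
    _ ≤ ∑ j ∈ Finset.Ioc N (3 * N), a j * (Real.exp (-(j * σ)) * Real.sin (j * t / 2) ^ 2) := by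
        rw [Finset.mul_sum]
        apply Finset.sum_le_sum
        intro j hj
        obtain ⟨g1, g2, g3⟩ := f3 j hj
        rw [← mul_assoc]
        exact mul_le_mul_of_nonneg_right (h σ h0 j g2 g3) (sq_nonneg _)
    _ ≤ _ := by
        apply Finset.sum_le_sum_of_subset_of_nonneg
        · intro j hj; exact (f3 j hj).1
        · intro j _ _; positivity

lemma domination (r c C₂ : ℝ) (hr : 0 < r) (hc : 0 < c) (hC₂ : 0 < C₂) :
    ∃ K : ℝ, 0 < K ∧ ∀ δ B t : ℝ, 0 < δ → δ ≤ 1 → B ^ 2 ≤ C₂ * δ ^ (-(2 + r)) → |t| ≤ Real.pi →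
      Real.exp (-(c * δ ^ (-r) * min 1 ((t / δ) ^ 2))) ≤ K * (1 + (t * B) ^ 2)⁻¹ := by
  obtain ⟨K1, hK1, h1⟩ := aux_bdd_nonneg ((2 + r) / r) c (by positivity) hc
  obtain ⟨K2, hK2, h2⟩ := aux_bdd_nonneg 1 (c / C₂) (by norm_num) (by positivity)
  refine ⟨(1 + Real.pi ^ 2 * C₂) * K1 + (1 + K2), by positivity, fun δ B t h0 hδ1 hB ht => ?_⟩
  rw [← div_eq_mul_inv, le_div_iff₀ (by positivity)]
  have ht2 : t ^ 2 ≤ Real.pi ^ 2 := by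
    rw [← sq_abs]; gcongr
  rcases le_total 1 ((t / δ) ^ 2) with h | h
  · rw [min_eq_left h, mul_one]
    have k1 := h1 (δ ^ (-r)) (by positivity)
    have k2 : (δ ^ (-r)) ^ ((2 + r) / r) = δ ^ (-(2 + r)) := by
      rw [← Real.rpow_mul h0.le]; congr 1; field_simp
    rw [k2] at k1
    have k3 : 1 ≤ δ ^ (-(2 + r)) := Real.one_le_rpow_of_pos_of_le_one_of_nonpos h0 hδ1 (by linarith)
    have k4 : 1 + (t * B) ^ 2 ≤ (1 + Real.pi ^ 2 * C₂) * δ ^ (-(2 + r)) := by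
      rw [mul_pow]
      have : t ^ 2 * B ^ 2 ≤ Real.pi ^ 2 * (C₂ * δ ^ (-(2 + r))) := by gcongr
      linarith
    calc Real.exp (-(c * δ ^ (-r))) * (1 + (t * B) ^ 2)
        ≤ Real.exp (-(c * δ ^ (-r))) * ((1 + Real.pi ^ 2 * C₂) * δ ^ (-(2 + r))) := by gcongr
      _ = (1 + Real.pi ^ 2 * C₂) * (δ ^ (-(2 + r)) * Real.exp (-(c * δ ^ (-r)))) := by ring
      _ ≤ (1 + Real.pi ^ 2 * C₂) * K1 := by gcongr
      _ ≤ _ := by linarith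
  · rw [min_eq_right h]
    set u := (t * B) ^ 2 with hu
    have k1 : c / C₂ * u ≤ c * δ ^ (-r) * (t / δ) ^ 2 := by
      have e : δ ^ (-r) * (t / δ) ^ 2 = t ^ 2 * δ ^ (-(2 + r)) := by
        rw [show -(2 + r) = (-r) + (-2 : ℤ) by push_cast; ring, Real.rpow_add h0, Real.rpow_intCast, zpow_neg,
          div_pow]
        norm_cast
        ring
      rw [mul_assoc, e, hu, mul_pow]
      calc c / C₂ * (t ^ 2 * B ^ 2) ≤ c / C₂ * (t ^ 2 * (C₂ * δ ^ (-(2 + r)))) := by gcongr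
        _ = _ := by field_simp
    have hu0 : 0 ≤ u := sq_nonneg _
    have k2 : Real.exp (-(c * δ ^ (-r) * (t / δ) ^ 2)) ≤ Real.exp (-(c / C₂ * u)) :=
      Real.exp_le_exp.2 (by linarith)
    have k3 : u * Real.exp (-(c / C₂ * u)) ≤ K2 := by
      rcases hu0.eq_or_lt with h' | h'
      · rw [← h']; simp; exact hK2.le
      · simpa using h2 u h'
    have k4 : Real.exp (-(c / C₂ * u)) ≤ 1 := by
      rw [Real.exp_le_one_iff]
      have : 0 ≤ c / C₂ * u := by positivity
      linarith
    calc Real.exp (-(c * δ ^ (-r) * (t / δ) ^ 2)) * (1 + u) ≤ Real.exp (-(c / C₂ * u)) * (1 + u) := by gcongr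
      _ = Real.exp (-(c / C₂ * u)) + u * Real.exp (-(c / C₂ * u)) := by ring
      _ ≤ 1 + K2 := by linarith
      _ ≤ _ := by
        have : 0 ≤ (1 + Real.pi ^ 2 * C₂) * K1 := by positivity
        linarith
noncomputable def mm (σ : ℝ) (j : ℕ) : ℝ := Real.exp (-(j * σ)) / (1 - Real.exp (-(j * σ)))

noncomputable def phi (a : ℕ → ℕ) (n : ℕ) (σ t : ℝ) : ℂ :=
  ∏ j ∈ Finset.Icc 1 n, ((1 - (mm σ j : ℂ) * (Complex.exp ((j * t : ℝ) * Complex.I) - 1))⁻¹) ^ (a j)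

noncomputable def L3 (a : ℕ → ℕ) (n : ℕ) (σ : ℝ) : ℝ :=
  ∑ j ∈ Finset.Icc 1 n, (j : ℝ) ^ 3 * (a j) * Real.exp (-(j * σ)) / (1 - Real.exp (-(j * σ))) ^ 3

lemma x_facts (σ : ℝ) (hσ : 0 < σ) (j : ℕ) (hj : 1 ≤ j) :
    0 < Real.exp (-(j * σ)) ∧ 0 < 1 - Real.exp (-(j * σ)) := by
  have hj0 : (0 : ℝ) < j := by exact_mod_cast hj
  refine ⟨Real.exp_pos _, ?_⟩
  have : Real.exp (-(j * σ)) < 1 := by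
    rw [Real.exp_lt_one_iff]
    have : 0 < j * σ := by positivity
    linarith
  linarith

lemma mm_nonneg (σ : ℝ) (hσ : 0 < σ) (j : ℕ) (hj : 1 ≤ j) : 0 ≤ mm σ j := by
  obtain ⟨h1, h2⟩ := x_facts σ hσ j hj
  unfold mm; positivity

lemma one_add_mm (σ : ℝ) (hσ : 0 < σ) (j : ℕ) (hj : 1 ≤ j) :
    1 + mm σ j = 1 / (1 - Real.exp (-(j * σ))) := by
  obtain ⟨h1, h2⟩ := x_facts σ hσ j hj
  unfold mm; field_simp; ring

lemma phi_continuous (a : ℕ → ℕ) (n : ℕ) (σ : ℝ) (hσ : 0 < σ) : Continuous (phi a n σ) := by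
  unfold phi
  apply continuous_finsetProd
  intro j hj
  apply Continuous.pow
  apply Continuous.inv₀
  · fun_prop
  · intro t h
    have := one_sub_w_norm (mm σ j) (j * t) (mm_nonneg σ hσ j (Finset.mem_Icc.1 hj).1)
    rw [h] at this
    simp at this
    linarith

lemma phi_norm (a : ℕ → ℕ) (n : ℕ) (σ t : ℝ) (hσ : 0 < σ) :
    ‖phi a n σ t‖ ≤ Real.exp (-(2 / 5 *
      ∑ j ∈ Finset.Icc 1 n, a j * (Real.exp (-(j * σ)) * Real.sin (j * t / 2) ^ 2))) := by
  unfold phi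
  rw [norm_prod, Finset.mul_sum, ← Finset.sum_neg_distrib, Real.exp_sum]
  apply Finset.prod_le_prod
  · intros; positivity
  intro j hj
  have hj1 := (Finset.mem_Icc.1 hj).1
  obtain ⟨h1, h2⟩ := x_facts σ hσ j hj1
  have hm := mm_nonneg σ hσ j hj1
  have key := F_norm_le (Real.exp (-(j * σ))) (mm σ j) (j * t) h1.le (by linarith) hm (by
    rw [one_add_mm σ hσ j hj1]
    unfold mm
    rw [div_mul_div_comm, mul_one, le_div_iff₀ (by positivity)]
    have : (1 - Real.exp (-(j * σ))) * (1 - Real.exp (-(j * σ))) ≤ 1 := by nlinarith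
    nlinarith)
  rw [norm_pow]
  calc _ ≤ (Real.exp (-(2 / 5 * (Real.exp (-(j * σ)) * Real.sin (j * t / 2) ^ 2)))) ^ (a j) := by gcongr
    _ = _ := by rw [← Real.exp_nat_mul]; congr 1; ring

lemma phi_factor (a : ℕ → ℕ) (n : ℕ) (σ t : ℝ) (hσ : 0 < σ) :
    (∏ j ∈ Finset.Icc 1 n, (1 - ((Real.exp (-σ) : ℂ) * Complex.exp (t * Complex.I)) ^ j) ^ (a j))⁻¹ =
      ((∏ j ∈ Finset.Icc 1 n, (1 - Real.exp (-(j * σ))) ^ (-(a j : ℤ)) : ℝ) : ℂ) * phi a n σ t := by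
  unfold phi
  push_cast
  rw [← Finset.prod_mul_distrib, ← Finset.prod_inv_distrib]
  apply Finset.prod_congr rfl
  intro j hj
  have hj1 := (Finset.mem_Icc.1 hj).1
  obtain ⟨h1, h2⟩ := x_facts σ hσ j hj1
  rw [zpow_neg, zpow_natCast, ← inv_pow, ← inv_pow, ← mul_pow, ← mul_inv]
  congr 2
  have e1 : ((Complex.exp (-(σ : ℂ))) * Complex.exp (t * Complex.I)) ^ j =
      Complex.exp (-(j * σ)) * Complex.exp (j * t * Complex.I) := by
    rw [mul_pow, ← Complex.exp_nat_mul, ← Complex.exp_nat_mul]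
    congr 2 <;> ring
  rw [e1]
  have e2 : (1 - Complex.exp (-(j * σ))) ≠ 0 := by
    have : (1 - Complex.exp (-(j * σ))) = ((1 - Real.exp (-(j * σ)) : ℝ) : ℂ) := by push_cast; ring
    rw [this]
    exact_mod_cast h2.ne'
  unfold mm
  push_cast
  field_simp
  ring

lemma phi_log (a : ℕ → ℕ) (n : ℕ) (σ t : ℝ) (hσ : 0 < σ) :
    ∃ Ψ : ℂ, ‖Ψ‖ ≤ L3 a n σ * |t| ^ 3 ∧
      phi a n σ t * Complex.exp (-(Mfun a n σ * t * Complex.I)) =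
        Complex.exp (Ψ - B2 a n σ * t ^ 2 / 2) := by
  refine ⟨∑ j ∈ Finset.Icc 1 n, (a j : ℂ) *
    (-Complex.log (1 - (mm σ j : ℂ) * (Complex.exp ((j * t : ℝ) * Complex.I) - 1))
      - mm σ j * (j * t : ℝ) * Complex.I + (mm σ j * (1 + mm σ j)) * (j * t : ℝ) ^ 2 / 2), ?_, ?_⟩
  · unfold L3
    rw [Finset.sum_mul]
    refine (norm_sum_le _ _).trans (Finset.sum_le_sum fun j hj => ?_)
    have hj1 := (Finset.mem_Icc.1 hj).1
    obtain ⟨h1, h2⟩ := x_facts σ hσ j hj1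
    rw [norm_mul, Complex.norm_natCast]
    have key := log_taylor (mm σ j) (j * t) (mm_nonneg σ hσ j hj1)
    calc _ ≤ (a j : ℝ) * (mm σ j * (1 + mm σ j) ^ 2 * |j * t| ^ 3) := by gcongr
      _ = _ := by
        rw [one_add_mm σ hσ j hj1, abs_mul, Nat.abs_cast]
        unfold mm
        field_simp
  · have e1 : phi a n σ t = Complex.exp (∑ j ∈ Finset.Icc 1 n, (a j : ℂ) *
        (-Complex.log (1 - (mm σ j : ℂ) * (Complex.exp ((j * t : ℝ) * Complex.I) - 1)))) := by
      unfold phi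
      rw [Complex.exp_sum]
      apply Finset.prod_congr rfl
      intro j hj
      have hj1 := (Finset.mem_Icc.1 hj).1
      rw [Complex.exp_nat_mul, Complex.exp_neg, Complex.exp_log]
      intro h
      have := one_sub_w_norm (mm σ j) (j * t) (mm_nonneg σ hσ j hj1)
      rw [h] at this
      simp at this
      linarith
    rw [e1, ← Complex.exp_add]
    congr 1
    have e2 : Mfun a n σ = ∑ j ∈ Finset.Icc 1 n, (a j : ℝ) * (mm σ j * j) := by
      unfold Mfun
      apply Finset.sum_congr rfl
      intro j _
      unfold mm; ring
    have e3 : B2 a n σ = ∑ j ∈ Finset.Icc 1 n, (a j : ℝ) * (mm σ j * (1 + mm σ j) * (j : ℝ) ^ 2) := by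
      unfold B2
      apply Finset.sum_congr rfl
      intro j hj
      have hj1 := (Finset.mem_Icc.1 hj).1
      obtain ⟨h1, h2⟩ := x_facts σ hσ j hj1
      rw [one_add_mm σ hσ j hj1]
      unfold mm; field_simp
    rw [e2, e3]
    push_cast
    rw [Finset.sum_mul, Finset.sum_mul, ← Finset.sum_neg_distrib, Finset.sum_mul, Finset.sum_div,
      ← Finset.sum_add_distrib, ← Finset.sum_sub_distrib]
    apply Finset.sum_congr rfl
    intro j _
    ring

lemma ratio_eq (a : ℕ → ℕ) (n : ℕ) (σ : ℝ) (hσ : 0 < σ) (hB : 0 < B2 a n σ) :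
    (((multisetCount a n : ℝ) /
        (Real.exp (n * σ) / Real.sqrt (2 * Real.pi * B2 a n σ) *
          ∏ j ∈ Finset.Icc 1 n, (1 - Real.exp (-(j * σ))) ^ (-(a j : ℤ))) : ℝ) : ℂ) =
      ((Real.sqrt (2 * Real.pi))⁻¹ : ℝ) *
        ∫ s : ℝ, (Set.Ioc (-(Real.pi * Real.sqrt (B2 a n σ))) (Real.pi * Real.sqrt (B2 a n σ))).indicator
          (fun s => phi a n σ (s / Real.sqrt (B2 a n σ)) *
            Complex.exp (-(n * (s / Real.sqrt (B2 a n σ) : ℝ) * Complex.I))) s := by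
  set B := Real.sqrt (B2 a n σ) with hBdef
  have hB0 : 0 < B := Real.sqrt_pos.2 hB
  have hpi := Real.pi_pos
  set P : ℝ := ∏ j ∈ Finset.Icc 1 n, (1 - Real.exp (-(j * σ))) ^ (-(a j : ℤ)) with hP
  have hP0 : 0 < P := by
    apply Finset.prod_pos
    intro j hj
    exact zpow_pos (x_facts σ hσ j (Finset.mem_Icc.1 hj).1).2 _
  set f : ℝ → ℂ := fun t => phi a n σ t * Complex.exp (-(n * t * Complex.I)) with hf
  have h1 := coeff_integral a n (Real.exp (-σ)) (Real.exp_pos _) (by rw [Real.exp_lt_one_iff]; linarith)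
  simp only [phi_factor a n σ _ hσ, mul_assoc] at h1
  rw [intervalIntegral.integral_const_mul] at h1
  have h2 : (∫ s : ℝ, (Set.Ioc (-(Real.pi * B)) (Real.pi * B)).indicator
          (fun s => phi a n σ (s / B) * Complex.exp (-(n * (s / B : ℝ) * Complex.I))) s) =
      B * ∫ t in (-Real.pi)..Real.pi, f t := by
    rw [MeasureTheory.integral_indicator measurableSet_Ioc,
      ← intervalIntegral.integral_of_le (by nlinarith)]
    have := intervalIntegral.integral_comp_div (a := -(Real.pi * B)) (b := Real.pi * B) f hB0.ne'
    rw [neg_div, mul_div_assoc, div_self hB0.ne', mul_one, Complex.real_smul] at this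
    exact this
  rw [h2]
  have h3 : ∫ t in (-Real.pi)..Real.pi, f t =
      (multisetCount a n : ℂ) * ((Real.exp (-σ) : ℝ) ^ n * (2 * Real.pi)) / P := by
    have hPc : (P : ℂ) ≠ 0 := by exact_mod_cast hP0.ne'
    rw [eq_div_iff hPc, h1, mul_comm]
    congr 1
    simp only [hf, mul_assoc]
  rw [h3]
  norm_cast
  have h4 : Real.sqrt (2 * Real.pi * B2 a n σ) = Real.sqrt (2 * Real.pi) * B := by
    rw [Real.sqrt_mul (by positivity)]
  have h5 : Real.exp (-σ) ^ n = (Real.exp (n * σ))⁻¹ := by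
    rw [← Real.exp_nat_mul, ← Real.exp_neg]; congr 1; ring
  rw [h4, h5]
  have h6 : 0 < Real.sqrt (2 * Real.pi) := Real.sqrt_pos.2 (by positivity)
  have h7 := Real.mul_self_sqrt (show 0 ≤ 2 * Real.pi by positivity)
  have h8 : 2 * Real.pi = Real.sqrt (2 * Real.pi) * Real.sqrt (2 * Real.pi) := h7.symm
  set q := Real.sqrt (2 * Real.pi)
  rw [h8]
  have h9 := Real.exp_pos (n * σ)
  field_simp

lemma delta_props (a : ℕ → ℕ) (r y D₁ D₂ : ℝ) (hr : 0 < r) (hy : 1 ≤ y) (hD₁ : 0 < D₁) (hD₂ : 0 < D₂)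
    (ha1 : ∀ j : ℕ, 1 ≤ j → D₁ * (j : ℝ) ^ (r - 1) * y ^ j ≤ (a j : ℝ))
    (ha2 : ∀ j : ℕ, 1 ≤ j → (a j : ℝ) ≤ D₂ * (j : ℝ) ^ (r - 1) * y ^ j)
    (σ : ℕ → ℝ) (hσ : ∀ n : ℕ, 1 ≤ n → 0 < σ n ∧ Mfun a n (σ n) = n) :
    (∀ᶠ n : ℕ in atTop, 0 < σ n - Real.log y ∧ 3 ≤ n * (σ n - Real.log y)) ∧
      Tendsto (fun n => σ n - Real.log y) atTop (nhds 0) := by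
  have h1 : ∀ᶠ n : ℕ in atTop, 0 < σ n - Real.log y ∧ 3 ≤ n * (σ n - Real.log y) := by
    have hc : 0 < D₁ * Real.exp (-3) := by positivity
    have ht : Tendsto (fun n : ℕ => (n / 2 : ℝ) ^ r) atTop atTop :=
      (tendsto_rpow_atTop hr).comp (tendsto_natCast_atTop_atTop.atTop_div_const (by norm_num))
    filter_upwards [ht.eventually_gt_atTop (2 / (D₁ * Real.exp (-3))), eventually_ge_atTop 1] with n hn hn1
    obtain ⟨s1, s2⟩ := hσ n hn1
    have hn0 : (0 : ℝ) < n := by exact_mod_cast hn1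
    have h3 : 3 ≤ n * (σ n - Real.log y) := by
      by_contra hlt
      push Not at hlt
      have := M_lower a r y D₁ (σ n) hr hy hD₁ ha1 n s1 3 (by norm_num) hn1 hlt.le
      rw [s2] at this
      rw [div_lt_iff₀ hc] at hn
      nlinarith
    refine ⟨?_, h3⟩
    by_contra hneg
    push Not at hneg
    nlinarith
  refine ⟨h1, ?_⟩
  obtain ⟨C, hC, hM⟩ := upper_sum a r y D₂ hr hy hD₂ ha2 1
  rw [tendsto_order]
  refine ⟨fun ε hε => ?_, fun ε hε => ?_⟩
  · filter_upwards [h1] with n hn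
    linarith [hn.1]
  · filter_upwards [h1, eventually_ge_atTop 1,
      tendsto_natCast_atTop_atTop.eventually_gt_atTop (C * ε ^ (-(((1 : ℕ) : ℝ) + r)))] with n hn hn1 hn2
    by_contra hge
    push Not at hge
    have h2 := hM n (σ n) hn.1
    simp only [pow_one] at h2
    have h3 := (hσ n hn1).2
    unfold Mfun at h3
    rw [h3] at h2
    have h4 : (σ n - Real.log y) ^ (-(((1 : ℕ) : ℝ) + r)) ≤ ε ^ (-(((1 : ℕ) : ℝ) + r)) :=
      Real.rpow_le_rpow_of_nonpos hε hge (by push_cast; linarith)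
    have h5 := mul_le_mul_of_nonneg_left h4 hC.le
    linarith

/-- main theorem: under condition (exp),
`c_n ∼ (e^{nσ_n}/√(2π B_n²)) · Π_{j=1}^n (1 - e^{-jσ_n})^{-a_j}`. -/
theorem multiset_main_asymptotics (a : ℕ → ℕ) (r y : ℝ) (hr : 0 < r) (hy : 1 ≤ y)
    (hexp : ExpansiveCond a r y)
    (σ : ℕ → ℝ) (hσ : ∀ n : ℕ, 1 ≤ n → 0 < σ n ∧ Mfun a n (σ n) = n) :
    Tendsto (fun n : ℕ =>
      (multisetCount a n : ℝ) /
        (Real.exp (n * σ n) / Real.sqrt (2 * Real.pi * B2 a n (σ n)) *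
          ∏ j ∈ Finset.Icc 1 n, (1 - Real.exp (-(j * σ n))) ^ (-(a j : ℤ))))
      atTop (nhds 1) := by
  obtain ⟨D₁, D₂, hD₁, hD₂, ha⟩ := hexp
  have ha1 := fun j hj => (ha j hj).1
  have ha2 := fun j hj => (ha j hj).2
  obtain ⟨hd1, hd2⟩ := delta_props a r y D₁ D₂ hr hy hD₁ hD₂ ha1 ha2 σ hσ
  obtain ⟨C₂, hC₂, hU2⟩ := upper_sum a r y D₂ hr hy hD₂ ha2 2
  obtain ⟨C₃, hC₃, hU3⟩ := upper_sum a r y D₂ hr hy hD₂ ha2 3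
  obtain ⟨c, hc, hL⟩ := B2_lower a r y D₁ hy hD₁ ha1
  obtain ⟨e, he, hE⟩ := E_lower a r y D₁ hy hD₁ ha1
  obtain ⟨K, hK, hdom⟩ := domination r (2 / 5 * e) C₂ hr (by positivity) hC₂
  set δ : ℕ → ℝ := fun n => σ n - Real.log y with hδ
  have hgood : ∀ᶠ n : ℕ in atTop, 1 ≤ n ∧ 0 < δ n ∧ δ n ≤ 1 ∧ 3 ≤ n * δ n := by
    filter_upwards [hd1, eventually_ge_atTop 1, hd2.eventually_le_const (zero_lt_one)] with n h1 h2 h3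
    exact ⟨h2, h1.1, h3, h1.2⟩
  have hpos : ∀ n : ℕ, 1 ≤ n ∧ 0 < δ n ∧ δ n ≤ 1 ∧ 3 ≤ n * δ n → 0 < B2 a n (σ n) := by
    rintro n ⟨h1, h2, h3, h4⟩
    refine lt_of_lt_of_le ?_ (hL (σ n) n h2 h3 h4)
    have := Real.rpow_pos_of_pos h2 (-(2 + r))
    positivity
  have hδpos : Tendsto δ atTop (nhdsWithin 0 (Set.Ioi 0)) := by
    rw [tendsto_nhdsWithin_iff]
    exact ⟨hd2, hgood.mono fun n h => h.2.1⟩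
  have hB2top : Tendsto (fun n => B2 a n (σ n)) atTop atTop := by
    have h1 : Tendsto (fun n => c * δ n ^ (-(2 + r))) atTop atTop :=
      Tendsto.const_mul_atTop hc
        ((tendsto_rpow_neg_nhdsGT_zero (by linarith : -(2 + r) < 0)).comp hδpos)
    refine tendsto_atTop_mono' _ ?_ h1
    filter_upwards [hgood] with n h
    exact hL (σ n) n h.2.1 h.2.2.1 h.2.2.2
  have hBtop : Tendsto (fun n => Real.sqrt (B2 a n (σ n))) atTop atTop :=
    Real.tendsto_sqrt_atTop.comp hB2top
  have hL3 : ∀ s : ℝ, Tendsto (fun n => L3 a n (σ n) * |s / Real.sqrt (B2 a n (σ n))| ^ 3) atTop (nhds 0) := by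
    intro s
    have h1 : Tendsto (fun n => C₃ / c ^ (3 / 2 : ℝ) * |s| ^ 3 * δ n ^ (r / 2)) atTop (nhds 0) := by
      have := (hd2.rpow_const (p := r / 2) (Or.inr (by positivity))).const_mul (C₃ / c ^ (3 / 2 : ℝ) * |s| ^ 3)
      rwa [Real.zero_rpow (by positivity), mul_zero] at this
    refine tendsto_of_tendsto_of_tendsto_of_le_of_le' tendsto_const_nhds h1 ?_ ?_
    · filter_upwards [hgood] with n h
      refine mul_nonneg ?_ (by positivity)
      unfold L3
      refine Finset.sum_nonneg fun j hj => ?_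
      obtain ⟨x1, x2⟩ := x_facts (σ n) (hσ n h.1).1 j (Finset.mem_Icc.1 hj).1
      positivity
    · filter_upwards [hgood] with n h
      obtain ⟨h1, h2, h3, h4⟩ := h
      have hB := hpos n ⟨h1, h2, h3, h4⟩
      have hl := hL (σ n) n h2 h3 h4
      have hu : L3 a n (σ n) ≤ C₃ * δ n ^ (-(3 + r)) := by
        have := hU3 n (σ n) h2
        push_cast at this
        exact this
      have hp := Real.rpow_pos_of_pos h2 (-(2 + r))
      have hB3 : Real.sqrt (B2 a n (σ n)) ^ 3 = B2 a n (σ n) ^ (3 / 2 : ℝ) := by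
        rw [Real.sqrt_eq_rpow, ← Real.rpow_natCast, ← Real.rpow_mul hB.le]
        norm_num
      have hlow : c ^ (3 / 2 : ℝ) * δ n ^ (-(3 + r) - r / 2) ≤ Real.sqrt (B2 a n (σ n)) ^ 3 := by
        rw [hB3]
        have h5 : (c * δ n ^ (-(2 + r))) ^ (3 / 2 : ℝ) ≤ B2 a n (σ n) ^ (3 / 2 : ℝ) :=
          Real.rpow_le_rpow (by positivity) hl (by norm_num)
        rw [Real.mul_rpow hc.le hp.le, ← Real.rpow_mul h2.le] at h5
        convert h5 using 3
        ring
      rw [abs_div, abs_of_nonneg (Real.sqrt_nonneg _), div_pow]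
      have hcp := Real.rpow_pos_of_pos hc (3 / 2)
      have hq := Real.rpow_pos_of_pos h2 (-(3 + r) - r / 2)
      have hq2 := Real.rpow_pos_of_pos h2 (-(3 + r))
      calc L3 a n (σ n) * (|s| ^ 3 / Real.sqrt (B2 a n (σ n)) ^ 3)
          ≤ (C₃ * δ n ^ (-(3 + r))) * (|s| ^ 3 / (c ^ (3 / 2 : ℝ) * δ n ^ (-(3 + r) - r / 2))) := by
            gcongr
        _ = C₃ / c ^ (3 / 2 : ℝ) * |s| ^ 3 * δ n ^ (r / 2) := by
            rw [Real.rpow_sub h2]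
            have := Real.rpow_pos_of_pos h2 (r / 2)
            field_simp
  -- the integrals
  have hIntLim : Tendsto (fun n : ℕ => ∫ s : ℝ,
      (Set.Ioc (-(Real.pi * Real.sqrt (B2 a n (σ n)))) (Real.pi * Real.sqrt (B2 a n (σ n)))).indicator
          (fun s => phi a n (σ n) (s / Real.sqrt (B2 a n (σ n))) *
            Complex.exp (-(n * (s / Real.sqrt (B2 a n (σ n)) : ℝ) * Complex.I))) s) atTop
      (nhds (∫ s : ℝ, ((Real.exp (-(1 / 2) * s ^ 2) : ℝ) : ℂ))) := by
    refine MeasureTheory.tendsto_integral_filter_of_dominated_convergence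
      (fun s => K * (1 + s ^ 2)⁻¹) ?_ ?_ (integrable_inv_one_add_sq.const_mul K) ?_
    · filter_upwards [hgood] with n h
      have hc1 := phi_continuous a n (σ n) (hσ n h.1).1
      refine (Continuous.aestronglyMeasurable ?_).indicator measurableSet_Ioc
      refine (hc1.comp (continuous_id.div_const _)).mul ?_
      fun_prop
    · filter_upwards [hgood] with n h
      refine Eventually.of_forall fun s => ?_
      by_cases hs : s ∈ Set.Ioc (-(Real.pi * Real.sqrt (B2 a n (σ n)))) (Real.pi * Real.sqrt (B2 a n (σ n)))
      · rw [Set.indicator_of_mem hs]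
        have hB := hpos n h
        have hB0 := Real.sqrt_pos.2 hB
        obtain ⟨h1, h2, h3, h4⟩ := h
        set t := s / Real.sqrt (B2 a n (σ n)) with ht
        have htB : t * Real.sqrt (B2 a n (σ n)) = s := by rw [ht]; field_simp
        have htp : |t| ≤ Real.pi := by
          rw [ht, abs_div, abs_of_pos hB0, div_le_iff₀ hB0, abs_le]
          exact ⟨hs.1.le, hs.2⟩
        have hn1 : ‖Complex.exp (-(n * (t : ℝ) * Complex.I))‖ = 1 := by
          have : (-(n * (t : ℝ) * Complex.I) : ℂ) = ((-(n * t) : ℝ) : ℂ) * Complex.I := by push_cast; ring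
          rw [this, Complex.norm_exp_ofReal_mul_I]
        rw [norm_mul, hn1, mul_one]
        refine (phi_norm a n (σ n) t (hσ n h1).1).trans ?_
        have hU := hU2 n (σ n) h2
        push_cast at hU
        have hd := hdom (δ n) (Real.sqrt (B2 a n (σ n))) t h2 h3
          (by rw [Real.sq_sqrt hB.le]; exact hU) htp
        rw [htB] at hd
        refine le_trans (Real.exp_le_exp.2 ?_) hd
        have := hE (σ n) n h2 h3 h4 t htp
        change e * δ n ^ (-r) * min 1 ((t / δ n) ^ 2) ≤ _ at this
        nlinarith [this]
      · rw [Set.indicator_of_notMem hs, norm_zero]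
        positivity
    · refine Eventually.of_forall fun s => ?_
      have hch : ∀ n : ℕ, ∃ Ψ : ℂ, 1 ≤ n → ‖Ψ‖ ≤ L3 a n (σ n) * |s / Real.sqrt (B2 a n (σ n))| ^ 3 ∧
          phi a n (σ n) (s / Real.sqrt (B2 a n (σ n))) *
            Complex.exp (-(n * (s / Real.sqrt (B2 a n (σ n)) : ℝ) * Complex.I)) =
          Complex.exp (Ψ - B2 a n (σ n) * ((s / Real.sqrt (B2 a n (σ n)) : ℝ) : ℂ) ^ 2 / 2) := by
        intro n
        by_cases hn : 1 ≤ n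
        · obtain ⟨Ψ, p1, p2⟩ := phi_log a n (σ n) (s / Real.sqrt (B2 a n (σ n))) (hσ n hn).1
          rw [(hσ n hn).2] at p2
          exact ⟨Ψ, fun _ => ⟨p1, by exact_mod_cast p2⟩⟩
        · exact ⟨0, fun h => absurd h hn⟩
      choose Ψ hΨ using hch
      have hΨ0 : Tendsto Ψ atTop (nhds 0) := by
        refine squeeze_zero_norm' ?_ (hL3 s)
        filter_upwards [eventually_ge_atTop 1] with n hn
        exact (hΨ n hn).1
      have hlim : Tendsto (fun n => Complex.exp (Ψ n - (s : ℂ) ^ 2 / 2)) atTop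
          (nhds ((Real.exp (-(1 / 2) * s ^ 2) : ℝ) : ℂ)) := by
        have h1 := (Complex.continuous_exp.tendsto _).comp (hΨ0.sub_const ((s : ℂ) ^ 2 / 2))
        have h2 : ((Real.exp (-(1 / 2) * s ^ 2) : ℝ) : ℂ) = Complex.exp (0 - (s : ℂ) ^ 2 / 2) := by
          push_cast
          congr 1
          ring
        rw [h2]
        exact h1
      refine hlim.congr' ?_
      have hbig : ∀ᶠ n in atTop, |s| < Real.pi * Real.sqrt (B2 a n (σ n)) :=
        (hBtop.const_mul_atTop Real.pi_pos).eventually_gt_atTop _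
      filter_upwards [hgood, hbig] with n h hb
      have hmem : s ∈ Set.Ioc (-(Real.pi * Real.sqrt (B2 a n (σ n)))) (Real.pi * Real.sqrt (B2 a n (σ n))) :=
        ⟨(abs_lt.1 hb).1, (abs_lt.1 hb).2.le⟩
      rw [Set.indicator_of_mem hmem, (hΨ n h.1).2]
      have hB := hpos n h
      have hid : B2 a n (σ n) * (s / Real.sqrt (B2 a n (σ n))) ^ 2 = s ^ 2 := by
        rw [div_pow, Real.sq_sqrt hB.le]
        field_simp
      have hid2 : (B2 a n (σ n) : ℂ) * ((s / Real.sqrt (B2 a n (σ n)) : ℝ) : ℂ) ^ 2 = (s : ℂ) ^ 2 := by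
        exact_mod_cast hid
      rw [hid2]
  have hgauss : (∫ s : ℝ, ((Real.exp (-(1 / 2) * s ^ 2) : ℝ) : ℂ)) = ((Real.sqrt (2 * Real.pi) : ℝ) : ℂ) := by
    rw [integral_complex_ofReal, integral_gaussian]
    congr 2
    field_simp
  rw [hgauss] at hIntLim
  have hmul := hIntLim.const_mul (((Real.sqrt (2 * Real.pi))⁻¹ : ℝ) : ℂ)
  have hne : Real.sqrt (2 * Real.pi) ≠ 0 := by
    have := Real.pi_pos
    positivity
  rw [← Complex.ofReal_mul, inv_mul_cancel₀ hne] at hmul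
  have hre := (Complex.continuous_re.tendsto _).comp hmul
  rw [Complex.ofReal_re] at hre
  refine hre.congr' ?_
  filter_upwards [hgood] with n h
  have := ratio_eq a n (σ n) (hσ n h.1).1 (hpos n h)
  rw [Function.comp_apply, ← this, Complex.ofReal_re]
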